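/- arXiv:2011.01107 — 7 statements merged into one kernel-verified Lean document; each statement's English description precedes it below -/
import Mathlib

section
/- Fix γ, k ∈ (0,1) and a compact set B ⊂ ℝ^d. For z = (x,y) ∈ ℝ^d × {0,1} let l(β;z) = log[q·(1−γ)^y γ^{1−y} + (1−q)·(1−γ^k)^y γ^{k(1−y)}] with q = (1+e^{−xᵀβ})^{−1}, and P_m l(β) = m^{−1}Σ_{i=1}^m l(β;z_i). Assume the z_i are independent (possibly non-identically distributed), sup_{1≤i≤m} E‖x_i‖² < ∞, and there exists a continuous function L : B → ℝ with sup_{β∈B}|E[P_m l(β)] − L(β)| → 0 as m → ∞. Then sup_{β∈B}|P_m l(β) − L(β)| → 0 in probability. -/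
open MeasureTheory ProbabilityTheory Filter
open scoped BigOperators

noncomputable section

/-- Inner product `xᵀβ`. -/
def dotp {d : ℕ} (x β : EuclideanSpace ℝ (Fin d)) : ℝ := ∑ i, x i * β i

/-- The quasi log-likelihood term `l(β;(x,y))`. -/
def lfun {d : ℕ} (γ k : ℝ) (x : EuclideanSpace ℝ (Fin d)) (y : ℝ)
    (β : EuclideanSpace ℝ (Fin d)) : ℝ :=
  Real.log ((1 + Real.exp (-dotp x β))⁻¹ * ((1 - γ) ^ y * γ ^ (1 - y))
    + (1 - (1 + Real.exp (-dotp x β))⁻¹) * ((1 - γ ^ k) ^ y * γ ^ (k * (1 - y))))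

/-- `P_m l(β) = m⁻¹ Σ_{i<m} l(β; z_i)`. -/
def Pml {Ω : Type*} {d : ℕ} (γ k : ℝ) (x : ℕ → Ω → EuclideanSpace ℝ (Fin d))
    (y : ℕ → Ω → ℝ) (m : ℕ) (ω : Ω) (β : EuclideanSpace ℝ (Fin d)) : ℝ :=
  (m : ℝ)⁻¹ * ∑ i ∈ Finset.range m, lfun γ k (x i ω) (y i ω) β

lemma sigm_lip (t t' : ℝ) : |Real.sigmoid t - Real.sigmoid t'| ≤ |t - t'| := by
  have h := Convex.norm_image_sub_le_of_norm_deriv_le (f := Real.sigmoid) (C := 1)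
    (s := Set.univ) (x := t') (y := t) (fun z _ => differentiableAt_sigmoid) (by
      intro z _
      rw [Real.deriv_sigmoid]
      have h1 := Real.sigmoid_nonneg z
      have h2 := Real.sigmoid_le_one z
      rw [Real.norm_eq_abs, abs_le]
      constructor <;> nlinarith) convex_univ trivial trivial
  simpa [Real.norm_eq_abs] using h

lemma log_lip {c u v : ℝ} (hc : 0 < c) (hu : c ≤ u) (hv : c ≤ v) :
    |Real.log u - Real.log v| ≤ c⁻¹ * |u - v| := by
  have key : ∀ u v : ℝ, c ≤ u → c ≤ v → Real.log u - Real.log v ≤ c⁻¹ * |u - v| := by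
    intro u v hu hv
    have hu0 : 0 < u := by linarith
    have hv0 : 0 < v := by linarith
    rw [← Real.log_div hu0.ne' hv0.ne']
    have h1 := Real.log_le_sub_one_of_pos (div_pos hu0 hv0)
    have h2 : u / v - 1 = v⁻¹ * (u - v) := by field_simp
    rw [h2] at h1
    refine h1.trans ?_
    calc v⁻¹ * (u - v) ≤ v⁻¹ * |u - v| := by
          gcongr; exact le_abs_self _
      _ ≤ c⁻¹ * |u - v| := by gcongr
  rw [abs_le]
  constructor
  · have := key v u hv hu
    rw [abs_sub_comm] at this
    linarith
  · exact key u v hu hv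

lemma core_props {a b c : ℝ} (hc : 0 < c) (ha : c ≤ a) (ha1 : a ≤ 1) (hb : c ≤ b) (hb1 : b ≤ 1)
    (t t' : ℝ) :
    |Real.log (Real.sigmoid t * a + (1 - Real.sigmoid t) * b)| ≤ c⁻¹ ∧
    |Real.log (Real.sigmoid t * a + (1 - Real.sigmoid t) * b)
      - Real.log (Real.sigmoid t' * a + (1 - Real.sigmoid t') * b)| ≤ c⁻¹ * |t - t'| := by
  have lb : ∀ t, c ≤ Real.sigmoid t * a + (1 - Real.sigmoid t) * b := by
    intro t
    have h1 := Real.sigmoid_nonneg t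
    have h2 := Real.sigmoid_le_one t
    nlinarith
  have ub : ∀ t, Real.sigmoid t * a + (1 - Real.sigmoid t) * b ≤ 1 := by
    intro t
    have h1 := Real.sigmoid_nonneg t
    have h2 := Real.sigmoid_le_one t
    nlinarith
  constructor
  · have h := log_lip hc (lb t) (by linarith [lb t, ub t] : c ≤ 1)
    rw [Real.log_one, sub_zero] at h
    refine h.trans ?_
    have : |Real.sigmoid t * a + (1 - Real.sigmoid t) * b - 1| ≤ 1 := by
      rw [abs_le]; constructor <;> linarith [lb t, ub t]
    calc _ ≤ c⁻¹ * 1 := by gcongr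
      _ = _ := mul_one _
  · refine (log_lip hc (lb t) (lb t')).trans ?_
    refine mul_le_mul_of_nonneg_left ?_ (inv_pos.2 hc).le
    have e : Real.sigmoid t * a + (1 - Real.sigmoid t) * b
        - (Real.sigmoid t' * a + (1 - Real.sigmoid t') * b)
        = (Real.sigmoid t - Real.sigmoid t') * (a - b) := by ring
    rw [e, abs_mul]
    have h1 : |a - b| ≤ 1 := by rw [abs_le]; constructor <;> linarith
    calc _ ≤ |t - t'| * 1 := by
          exact mul_le_mul (sigm_lip t t') h1 (abs_nonneg _) (abs_nonneg _)
      _ = _ := mul_one _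

lemma dotp_eq {d : ℕ} (x β : EuclideanSpace ℝ (Fin d)) : dotp x β = inner ℝ x β := by
  simp [dotp, PiLp.inner_apply, mul_comm]

lemma dotp_lip {d : ℕ} (x β β' : EuclideanSpace ℝ (Fin d)) :
    |dotp x β - dotp x β'| ≤ ‖x‖ * ‖β - β'‖ := by
  rw [dotp_eq, dotp_eq, ← inner_sub_right]
  exact abs_real_inner_le_norm _ _

lemma lfun_props {γ k : ℝ} (hγ : γ ∈ Set.Ioo (0:ℝ) 1) (hk : k ∈ Set.Ioo (0:ℝ) 1) (d : ℕ) :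
    ∃ K : ℝ, 0 < K ∧ ∀ (x : EuclideanSpace ℝ (Fin d)) (y : ℝ), (y = 0 ∨ y = 1) →
      ∀ β β' : EuclideanSpace ℝ (Fin d), |lfun γ k x y β| ≤ K ∧
        |lfun γ k x y β - lfun γ k x y β'| ≤ K * (‖x‖ * ‖β - β'‖) := by
  obtain ⟨hγ0, hγ1⟩ := hγ
  obtain ⟨hk0, hk1⟩ := hk
  have hp0 : 0 < γ ^ k := Real.rpow_pos_of_pos hγ0 k
  have hp1 : γ ^ k < 1 := Real.rpow_lt_one hγ0.le hγ1 hk0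
  set c := min (min γ (1 - γ)) (min (γ ^ k) (1 - γ ^ k)) with hcdef
  have hc : 0 < c := by
    simp only [hcdef, lt_min_iff]
    refine ⟨⟨?_, ?_⟩, ?_, ?_⟩ <;> linarith
  have c1 : c ≤ γ := (min_le_left _ _).trans (min_le_left _ _)
  have c2 : c ≤ 1 - γ := (min_le_left _ _).trans (min_le_right _ _)
  have c3 : c ≤ γ ^ k := (min_le_right _ _).trans (min_le_left _ _)
  have c4 : c ≤ 1 - γ ^ k := (min_le_right _ _).trans (min_le_right _ _)
  refine ⟨c⁻¹, inv_pos.2 hc, ?_⟩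
  intro x y hy β β'
  have hd := dotp_lip x β β'
  have hd' : c⁻¹ * |dotp x β - dotp x β'| ≤ c⁻¹ * (‖x‖ * ‖β - β'‖) := by gcongr
  rcases hy with rfl | rfl
  · have h := core_props hc c1 hγ1.le c3 hp1.le (dotp x β) (dotp x β')
    simp only [lfun, ← Real.sigmoid_def]
    simp only [Real.rpow_zero, sub_zero, Real.rpow_one, one_mul, mul_one]
    exact ⟨h.1, h.2.trans hd'⟩
  · have h := core_props hc c2 (by linarith) c4 (by linarith) (dotp x β) (dotp x β')
    simp only [lfun, ← Real.sigmoid_def]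
    simp only [Real.rpow_zero, sub_self, Real.rpow_one, mul_zero, mul_one]
    exact ⟨h.1, h.2.trans hd'⟩

lemma lfun_meas {d : ℕ} (γ k : ℝ) (β : EuclideanSpace ℝ (Fin d)) :
    Measurable (fun z : EuclideanSpace ℝ (Fin d) × ℝ => lfun γ k z.1 z.2 β) := by
  have h : Measurable (fun z : EuclideanSpace ℝ (Fin d) × ℝ => dotp z.1 β) := by
    simp only [dotp_eq]; fun_prop
  unfold lfun
  fun_prop

lemma lfun_meas' {Ω : Type*} [MeasurableSpace Ω] {d : ℕ} (γ k : ℝ)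
    (β : EuclideanSpace ℝ (Fin d)) (x : Ω → EuclideanSpace ℝ (Fin d)) (y : Ω → ℝ)
    (hx : Measurable x) (hy : Measurable y) :
    Measurable (fun ω => lfun γ k (x ω) (y ω) β) := by
  have h := (lfun_meas γ k β).comp (hx.prodMk hy)
  exact h

/-- Pointwise Chebyshev bound. -/
lemma cheb {Ω : Type*} [MeasurableSpace Ω] (μ : Measure Ω) [IsProbabilityMeasure μ]
    (X : ℕ → Ω → ℝ) (K : ℝ) (hm : ∀ i, Measurable (X i)) (hb : ∀ i ω, |X i ω| ≤ K)
    (hi : iIndepFun X μ) {e : ℝ} (he : 0 < e) (m : ℕ) :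
    μ.real {ω | e ≤ |(m:ℝ)⁻¹ * ∑ i ∈ Finset.range m, X i ω
      - ∫ ω, (m:ℝ)⁻¹ * ∑ i ∈ Finset.range m, X i ω ∂μ|} ≤ K ^ 2 / e ^ 2 * (m:ℝ)⁻¹ := by
  have hL : ∀ i, MemLp (X i) 2 μ := fun i =>
    MemLp.of_bound (hm i).aestronglyMeasurable K (ae_of_all _ (hb i))
  have hS : MemLp (fun ω => (m:ℝ)⁻¹ * ∑ i ∈ Finset.range m, X i ω) 2 μ :=
    (memLp_finsetSum _ (fun i _ => hL i)).const_mul _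
  have h1 := meas_ge_le_variance_div_sq hS he
  have hv : variance (fun ω => (m:ℝ)⁻¹ * ∑ i ∈ Finset.range m, X i ω) μ ≤ K ^ 2 * (m:ℝ)⁻¹ := by
    rw [variance_const_mul]
    have h2 := IndepFun.variance_sum (μ := μ) (X := X) (s := Finset.range m) (fun i _ => hL i)
      (fun i _ j _ hij => hi.indepFun hij)
    have e1 : (∑ i ∈ Finset.range m, X i) = fun ω => ∑ i ∈ Finset.range m, X i ω := by
      ext ω; simp
    rw [e1] at h2
    rw [h2]
    have h3 : ∑ i ∈ Finset.range m, variance (X i) μ ≤ ∑ i ∈ Finset.range m, K ^ 2 := by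
      refine Finset.sum_le_sum fun i _ => ?_
      have := variance_le_sq_of_bounded (μ := μ) (a := -K) (b := K) (X := X i)
        (ae_of_all _ fun ω => abs_le.1 (hb i ω)) (hm i).aemeasurable
      refine this.trans (le_of_eq ?_)
      ring
    rw [Finset.sum_const, Finset.card_range, nsmul_eq_mul] at h3
    calc _ ≤ ((m:ℝ)⁻¹) ^ 2 * (m * K ^ 2) := by gcongr
      _ = K ^ 2 * (m:ℝ)⁻¹ := by
        rcases Nat.eq_zero_or_pos m with rfl | hm0
        · simp
        · have : (m:ℝ) ≠ 0 := by positivity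
          field_simp
  have h4 := ENNReal.toReal_mono ENNReal.ofReal_ne_top h1
  rw [ENNReal.toReal_ofReal (div_nonneg (variance_nonneg _ _) (by positivity))] at h4
  refine h4.trans ?_
  calc _ ≤ K ^ 2 * (m:ℝ)⁻¹ / e ^ 2 := by gcongr
    _ = _ := by ring

/-- uniform law of large numbers, `sup_{β∈B} |P_m l(β) − L(β)| → 0` in
probability. -/
theorem stmt_4 {Ω : Type*} [MeasurableSpace Ω] (μ : Measure Ω) [IsProbabilityMeasure μ]
    {d : ℕ} (γ k : ℝ) (hγ : γ ∈ Set.Ioo (0:ℝ) 1) (hk : k ∈ Set.Ioo (0:ℝ) 1)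
    (B : Set (EuclideanSpace ℝ (Fin d))) (hB : IsCompact B)
    (x : ℕ → Ω → EuclideanSpace ℝ (Fin d)) (y : ℕ → Ω → ℝ)
    (hxmeas : ∀ i, Measurable (x i)) (hymeas : ∀ i, Measurable (y i))
    (hy01 : ∀ i ω, y i ω = 0 ∨ y i ω = 1)
    (hindep : iIndepFun (fun i ω => (x i ω, y i ω)) μ)
    (hmomInt : ∀ i, Integrable (fun ω => ‖x i ω‖ ^ 2) μ)
    (hmom : ∃ C : ℝ, ∀ i, (∫ ω, ‖x i ω‖ ^ 2 ∂μ) ≤ C)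
    (L : EuclideanSpace ℝ (Fin d) → ℝ) (hLcont : ContinuousOn L B)
    (hmean : Tendsto (fun m : ℕ =>
        ⨆ β : B, |(∫ ω, Pml γ k x y m ω β.1 ∂μ) - L β.1|) atTop (nhds 0)) :
    ∀ ε > (0:ℝ), Tendsto (fun m : ℕ =>
        (μ {ω | ε < ⨆ β : B, |Pml γ k x y m ω β.1 - L β.1|}).toReal)
      atTop (nhds 0) := by
  intro ε hε
  obtain ⟨K, hK, hprop⟩ := lfun_props hγ hk d
  obtain ⟨C, hC⟩ := hmom
  have hC0 : 0 ≤ C := (integral_nonneg (fun ω => by positivity)).trans (hC 0)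
  set C1 := C + 1 with hC1
  have hC1pos : 0 < C1 := by linarith
  -- basic facts about the summands
  have hlm : ∀ (β : EuclideanSpace ℝ (Fin d)) (i : ℕ),
      Measurable (fun ω => lfun γ k (x i ω) (y i ω) β) := fun β i =>
    lfun_meas' γ k β (x i) (y i) (hxmeas i) (hymeas i)
  have hlb : ∀ (β : EuclideanSpace ℝ (Fin d)) (i : ℕ) (ω : Ω), |lfun γ k (x i ω) (y i ω) β| ≤ K := fun β i ω =>
    (hprop _ _ (hy01 i ω) β β).1
  have hli : ∀ (β : EuclideanSpace ℝ (Fin d)), iIndepFun (fun i ω => lfun γ k (x i ω) (y i ω) β) μ := fun β =>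
    hindep.comp (fun _ z => lfun γ k z.1 z.2 β) (fun _ => lfun_meas γ k β)
  have hlint : ∀ (β : EuclideanSpace ℝ (Fin d)) (i : ℕ), Integrable (fun ω => lfun γ k (x i ω) (y i ω) β) μ := fun β i =>
    Integrable.of_bound (hlm β i).aestronglyMeasurable K (ae_of_all _ (hlb β i))
  have hPint : ∀ m β, Integrable (fun ω => Pml γ k x y m ω β) μ := fun m β =>
    (integrable_finsetSum _ (fun i _ => hlint β i)).const_mul _
  have hxi : ∀ i, Integrable (fun ω => ‖x i ω‖) μ := by
    intro i
    refine Integrable.mono' ((hmomInt i).add (integrable_const (1:ℝ)))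
      (hxmeas i).norm.aestronglyMeasurable (ae_of_all _ fun ω => ?_)
    simp only [norm_norm, Pi.add_apply]
    nlinarith [sq_nonneg (‖x i ω‖ - 1), norm_nonneg (x i ω)]
  have hxE : ∀ i, ∫ ω, ‖x i ω‖ ∂μ ≤ C1 := by
    intro i
    have : ∫ ω, ‖x i ω‖ ∂μ ≤ ∫ ω, (‖x i ω‖ ^ 2 + 1) ∂μ := by
      refine integral_mono (hxi i) ((hmomInt i).add (integrable_const (1:ℝ))) fun ω => ?_
      simp only
      nlinarith [sq_nonneg (‖x i ω‖ - 1), norm_nonneg (x i ω)]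
    rw [integral_add (hmomInt i) (integrable_const _)] at this
    simp only [integral_const, probReal_univ, smul_eq_mul, mul_one] at this
    linarith [hC i]
  let A : ℕ → Ω → ℝ := fun m ω => (m:ℝ)⁻¹ * ∑ i ∈ Finset.range m, ‖x i ω‖
  have hA0 : ∀ m ω, 0 ≤ A m ω := fun m ω => by positivity
  have hAint : ∀ m, Integrable (A m) μ := fun m =>
    (integrable_finsetSum _ (fun i _ => hxi i)).const_mul _
  have hAE : ∀ m, ∫ ω, A m ω ∂μ ≤ C1 := by
    intro m
    simp only [A]
    rw [integral_const_mul, integral_finsetSum _ (fun i _ => hxi i)]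
    rcases Nat.eq_zero_or_pos m with rfl | hm0
    · simpa using hC1pos.le
    · have hs : ∑ i ∈ Finset.range m, ∫ ω, ‖x i ω‖ ∂μ ≤ ∑ i ∈ Finset.range m, C1 :=
        Finset.sum_le_sum fun i _ => hxE i
      rw [Finset.sum_const, Finset.card_range, nsmul_eq_mul] at hs
      have hm' : (0:ℝ) < m := by exact_mod_cast hm0
      rw [inv_mul_le_iff₀ hm']
      exact hs
  have hPlip : ∀ m ω β β', |Pml γ k x y m ω β - Pml γ k x y m ω β'|
      ≤ K * ‖β - β'‖ * A m ω := by
    intro m ω β β'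
    simp only [Pml, A]
    rw [← mul_sub, ← Finset.sum_sub_distrib, abs_mul, abs_of_nonneg (by positivity : (0:ℝ) ≤ (m:ℝ)⁻¹)]
    have : |∑ i ∈ Finset.range m, (lfun γ k (x i ω) (y i ω) β - lfun γ k (x i ω) (y i ω) β')|
        ≤ K * ‖β - β'‖ * ∑ i ∈ Finset.range m, ‖x i ω‖ := by
      refine (Finset.abs_sum_le_sum_abs _ _).trans ?_
      rw [Finset.mul_sum]
      refine Finset.sum_le_sum fun i _ => ((hprop _ _ (hy01 i ω) β β').2).trans (le_of_eq ?_)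
      ring
    calc _ ≤ (m:ℝ)⁻¹ * (K * ‖β - β'‖ * ∑ i ∈ Finset.range m, ‖x i ω‖) := by gcongr
      _ = _ := by ring
  have hPb : ∀ m ω β, |Pml γ k x y m ω β| ≤ K := by
    intro m ω β
    simp only [Pml]
    rw [abs_mul, abs_of_nonneg (by positivity : (0:ℝ) ≤ (m:ℝ)⁻¹)]
    rcases Nat.eq_zero_or_pos m with rfl | hm0
    · simpa using hK.le
    · have hm' : (0:ℝ) < m := by exact_mod_cast hm0
      rw [inv_mul_le_iff₀ hm']
      refine (Finset.abs_sum_le_sum_abs _ _).trans ?_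
      refine (Finset.sum_le_sum fun i _ => hlb β i ω).trans (le_of_eq ?_)
      simp
  set G : ℕ → EuclideanSpace ℝ (Fin d) → ℝ := fun m β => ∫ ω, Pml γ k x y m ω β ∂μ with hG
  have hGb : ∀ m β, |G m β| ≤ K := by
    intro m β
    have := norm_integral_le_of_norm_le_const (μ := μ) (f := fun ω => Pml γ k x y m ω β)
      (C := K) (ae_of_all _ fun ω => hPb m ω β)
    simpa using this
  have hGlip : ∀ m β β', |G m β - G m β'| ≤ K * ‖β - β'‖ * C1 := by
    intro m β β'
    simp only [hG]
    rw [← integral_sub (hPint m β) (hPint m β')]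
    rw [← Real.norm_eq_abs]
    calc ‖∫ ω, (Pml γ k x y m ω β - Pml γ k x y m ω β') ∂μ‖ ≤ ∫ ω, K * ‖β - β'‖ * A m ω ∂μ :=
          norm_integral_le_of_norm_le ((hAint m).const_mul _) (ae_of_all _ fun ω => hPlip m ω β β')
      _ = K * ‖β - β'‖ * ∫ ω, A m ω ∂μ := integral_const_mul _ _
      _ ≤ K * ‖β - β'‖ * C1 := mul_le_mul_of_nonneg_left (hAE m) (by positivity)
  obtain ⟨ML, hML⟩ := hB.exists_bound_of_continuousOn hLcont
  have hbdd : ∀ m, BddAbove (Set.range fun β : B => |G m β.1 - L β.1|) := by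
    intro m
    refine ⟨K + ML, ?_⟩
    rintro _ ⟨β, rfl⟩
    have h1 := hML β.1 β.2
    rw [Real.norm_eq_abs] at h1
    exact (abs_sub _ _).trans (add_le_add (hGb m β.1) h1)
  -- epsilon argument
  rw [Metric.tendsto_atTop']
  intro η hη
  set R := 4 * C1 / η with hR
  have hRpos : 0 < R := by positivity
  set δ := ε / (4 * K * (R + C1)) with hδ
  have hδpos : 0 < δ := by positivity
  have hδe : K * δ * R + K * δ * C1 = ε / 4 := by
    rw [hδ]; field_simp
  obtain ⟨t, htB, htfin, htcov⟩ := finite_cover_balls_of_compact hB hδpos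
  set T := htfin.toFinset with hT
  have hlim : Tendsto (fun m : ℕ => (T.card : ℝ) * (K ^ 2 / (ε / 4) ^ 2 * (m:ℝ)⁻¹)) atTop (nhds 0) := by
    have := (tendsto_inv_atTop_nhds_zero_nat (𝕜 := ℝ)).const_mul (T.card * (K ^ 2 / (ε / 4) ^ 2))
    simpa [mul_assoc] using this
  have ev1 : ∀ᶠ m : ℕ in atTop, (T.card : ℝ) * (K ^ 2 / (ε / 4) ^ 2 * (m:ℝ)⁻¹) < η / 2 :=
    hlim.eventually (gt_mem_nhds (by positivity))
  have ev2 : ∀ᶠ m : ℕ in atTop, (⨆ β : B, |G m β.1 - L β.1|) < ε / 4 :=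
    hmean.eventually (gt_mem_nhds (by positivity))
  obtain ⟨N, hN⟩ := eventually_atTop.1 (ev1.and ev2)
  refine ⟨N, fun m hm => ?_⟩
  obtain ⟨h1, h2⟩ := hN m hm.le
  rw [Real.dist_eq, sub_zero, abs_of_nonneg ENNReal.toReal_nonneg]
  have hsub : {ω | ε < ⨆ β : B, |Pml γ k x y m ω β.1 - L β.1|} ⊆
      {ω | R ≤ A m ω} ∪ ⋃ β ∈ T, {ω | ε / 4 ≤ |Pml γ k x y m ω β - G m β|} := by
    intro ω hω
    by_contra hcon
    simp only [Set.mem_union, Set.mem_iUnion, Set.mem_ofPred_eq, not_or, not_exists, not_le] at hcon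
    obtain ⟨hAR, hnet⟩ := hcon
    refine absurd hω (not_lt.2 (Real.iSup_le (fun β => ?_) hε.le))
    obtain ⟨b, hb, hβb⟩ := Set.mem_iUnion₂.1 (htcov β.2)
    rw [Metric.mem_ball, dist_eq_norm] at hβb
    have q1 : |Pml γ k x y m ω β.1 - Pml γ k x y m ω b| ≤ K * δ * R :=
      (hPlip m ω β.1 b).trans (by have := hA0 m ω; gcongr)
    have q2 := hnet b (htfin.mem_toFinset.2 hb)
    have q3 : |G m β.1 - G m b| ≤ K * δ * C1 := (hGlip m β.1 b).trans (by gcongr)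
    have q4 : |G m β.1 - L β.1| < ε / 4 := (le_ciSup (hbdd m) β).trans_lt h2
    rw [abs_le] at q1 q3 ⊢
    rw [abs_lt] at q2 q4
    constructor <;> linarith [q1.1, q1.2, q2.1, q2.2, q3.1, q3.2, q4.1, q4.2]
  have hm1 : μ.real {ω | R ≤ A m ω} ≤ η / 4 := by
    have h := mul_meas_ge_le_integral_of_nonneg (ae_of_all μ (hA0 m)) (hAint m) R
    have h' := h.trans (hAE m)
    rw [← le_div_iff₀' hRpos] at h'
    refine h'.trans (le_of_eq ?_)
    rw [hR]; field_simp
  have hm2 : μ.real (⋃ β ∈ T, {ω | ε / 4 ≤ |Pml γ k x y m ω β - G m β|}) < η / 2 := by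
    refine (measureReal_biUnion_finset_le _ _).trans_lt (lt_of_le_of_lt ?_ h1)
    rw [← nsmul_eq_mul]
    refine Finset.sum_le_card_nsmul _ _ _ fun β _ => ?_
    exact cheb μ (fun i ω => lfun γ k (x i ω) (y i ω) β) K (hlm β) (hlb β) (hli β)
      (by positivity) m
  have hfin : μ.real {ω | ε < ⨆ β : B, |Pml γ k x y m ω β.1 - L β.1|} < η := by
    refine ((measureReal_mono hsub).trans (measureReal_union_le _ _)).trans_lt ?_
    linarith
  exact hfin
end
end

section
/- Let {W_i}_{i=1}^m be independent real random variables with E[W_i] = 0 and sup_{1≤i≤m} E|W_i|^{q+ϵ} < ∞ for some q ≥ 2 and every ϵ > 0 (uniformly in m). Then for every t > 0: (a) P(|Σ_{i=1}^m W_i| > mt) = o(m^{1−q}) as m → ∞; (b) P(sup_{1≤j≤m}|Σ_{i≠j} W_i| > mt) = o(m^{1−q}); and (c) if the W_i are independent with sup_i E|W_i|^{q+ϵ} < ∞ but not necessarily mean-zero, then sup_{1≤j≤m} Σ_{i≠j} W_i = O_P(m). -/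
open MeasureTheory ProbabilityTheory Filter
open scoped BigOperators ENNReal

lemma aux_mom {Ω : Type*} [MeasurableSpace Ω] (μ : Measure Ω) [IsProbabilityMeasure μ]
    (W : (m : ℕ) → Fin m → Ω → ℝ)
    (hmeas : ∀ m i, Measurable (W m i))
    (q : ℝ) (hq : 2 ≤ q)
    (hmom : ∀ ϵ > (0:ℝ), ∃ C : ℝ, ∀ m (i : Fin m),
      Integrable (fun ω => |W m i ω| ^ (q + ϵ)) μ ∧
      (∫ ω, |W m i ω| ^ (q + ϵ) ∂μ) ≤ C) (p : ℕ) :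
    ∃ M : ℝ, 0 ≤ M ∧ ∀ m (i : Fin m),
      Integrable (fun ω => |W m i ω| ^ p) μ ∧ (∫ ω, |W m i ω| ^ p ∂μ) ≤ M := by
  obtain ⟨C, hC⟩ := hmom (p + 1) (by positivity)
  refine ⟨1 + |C|, by positivity, fun m i => ?_⟩
  obtain ⟨h1, h2⟩ := hC m i
  have hle : ∀ ω, |W m i ω| ^ p ≤ 1 + |W m i ω| ^ (q + ((p:ℝ) + 1)) := by
    intro ω
    have h0 := abs_nonneg (W m i ω)
    rcases le_total (|W m i ω|) 1 with h | h
    · have := pow_le_one₀ (n := p) h0 h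
      have := Real.rpow_nonneg h0 (q + ((p:ℝ) + 1))
      linarith
    · have : |W m i ω| ^ (p:ℝ) ≤ |W m i ω| ^ (q + ((p:ℝ) + 1)) :=
        Real.rpow_le_rpow_of_exponent_le h (by linarith)
      rw [Real.rpow_natCast] at this
      linarith
  have hg : Integrable (fun ω => 1 + |W m i ω| ^ (q + ((p:ℝ) + 1))) μ :=
    (integrable_const 1).add h1
  have hi : Integrable (fun ω => |W m i ω| ^ p) μ := by
    refine hg.mono' ?_ (Eventually.of_forall fun ω => ?_)
    · have := hmeas m i
      exact (by fun_prop : Measurable (fun ω => |W m i ω| ^ p)).aestronglyMeasurable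
    · rw [Real.norm_of_nonneg (by positivity)]
      exact hle ω
  refine ⟨hi, ?_⟩
  calc _ ≤ ∫ ω, 1 + |W m i ω| ^ (q + ((p:ℝ) + 1)) ∂μ := integral_mono hi hg hle
    _ = 1 + ∫ ω, |W m i ω| ^ (q + ((p:ℝ) + 1)) ∂μ := by
      rw [integral_add (integrable_const 1) h1]; simp
    _ ≤ 1 + |C| := by linarith [le_abs_self C]

section
variable {Ω : Type*} [MeasurableSpace Ω] {μ : Measure Ω} [IsProbabilityMeasure μ]

lemma aux_int {ι : Type*} {X : ι → Ω → ℝ} (hmeas : ∀ i, Measurable (X i))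
    (hindep : iIndepFun X μ) (hX : ∀ (p : ℕ) i, Integrable (fun ω => X i ω ^ p) μ)
    (s : Finset ι) : ∀ p : ℕ, Integrable (fun ω => (∑ i ∈ s, X i ω) ^ p) μ := by
  classical
  induction s using Finset.induction_on with
  | empty => intro p; simp
  | insert a s ha ih =>
    intro p
    simp only [Finset.sum_insert ha, add_pow]
    refine integrable_finsetSum _ fun k _ => Integrable.mul_const ?_ _
    have h := (hindep.indepFun_finsetSum_of_notMem hmeas ha).symm
    have h2 : IndepFun (fun ω => X a ω ^ k) (fun ω => (∑ i ∈ s, X i ω) ^ (p - k)) μ := by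
      have := h.comp (φ := fun x : ℝ => x ^ k) (ψ := fun x : ℝ => x ^ (p - k))
        (by fun_prop) (by fun_prop)
      simpa [Function.comp_def] using this
    exact h2.integrable_mul (hX k a) (ih (p - k))

lemma aux_step {ι : Type*} [DecidableEq ι] {X : ι → Ω → ℝ} (hmeas : ∀ i, Measurable (X i))
    (hindep : iIndepFun X μ) (hX : ∀ (p : ℕ) i, Integrable (fun ω => X i ω ^ p) μ)
    (h0 : ∀ i, ∫ ω, X i ω ∂μ = 0) (s : Finset ι) (a : ι) (ha : a ∉ s) (p : ℕ) :
    ∫ ω, (∑ i ∈ insert a s, X i ω) ^ (p + 2) ∂μ =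
      (∑ k ∈ Finset.range (p + 1), (∫ ω, X a ω ^ (k + 2) ∂μ) *
        (∫ ω, (∑ i ∈ s, X i ω) ^ (p - k) ∂μ) * ((p + 2).choose (k + 2) : ℝ)) +
      ∫ ω, (∑ i ∈ s, X i ω) ^ (p + 2) ∂μ := by
  have h := (hindep.indepFun_finsetSum_of_notMem hmeas ha).symm
  have h2 : ∀ k l : ℕ, IndepFun (fun ω => X a ω ^ k) (fun ω => (∑ i ∈ s, X i ω) ^ l) μ := by
    intro k l
    have := h.comp (φ := fun x : ℝ => x ^ k) (ψ := fun x : ℝ => x ^ l)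
      (by fun_prop) (by fun_prop)
    simpa [Function.comp_def] using this
  have hS := aux_int hmeas hindep hX s
  have h3 : ∀ k l : ℕ, ∫ ω, X a ω ^ k * (∑ i ∈ s, X i ω) ^ l ∂μ =
      (∫ ω, X a ω ^ k ∂μ) * ∫ ω, (∑ i ∈ s, X i ω) ^ l ∂μ := fun k l =>
    (h2 k l).integral_fun_mul_eq_mul_integral (hX k a).1 (hS l).1
  simp only [Finset.sum_insert ha, add_pow]
  have h4 : ∀ k l : ℕ, Integrable (fun ω => X a ω ^ k * (∑ i ∈ s, X i ω) ^ l) μ :=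
    fun k l => (h2 k l).integrable_mul (hX k a) (hS l)
  rw [integral_finsetSum _ fun k _ => Integrable.mul_const (h4 k _) _]
  simp only [integral_mul_const, h3]
  rw [Finset.sum_range_succ', Finset.sum_range_succ']
  simp [h0]

lemma aux_main (W : (m : ℕ) → Fin m → Ω → ℝ)
    (hmeas : ∀ m i, Measurable (W m i))
    (hindep : ∀ m, iIndepFun (W m) μ)
    (M : ℕ → ℝ) (hM0 : ∀ p, 0 ≤ M p)
    (hM : ∀ p m (i : Fin m),
      Integrable (fun ω => |W m i ω| ^ p) μ ∧ (∫ ω, |W m i ω| ^ p ∂μ) ≤ M p)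
    (h0 : ∀ m (i : Fin m), (∫ ω, W m i ω ∂μ) = 0) (p : ℕ) :
    ∃ C : ℝ, 0 ≤ C ∧ ∀ m (s : Finset (Fin m)),
      |∫ ω, (∑ i ∈ s, W m i ω) ^ p ∂μ| ≤ C * (s.card : ℝ) ^ (p / 2) := by
  have hX : ∀ m (p : ℕ) i, Integrable (fun ω => W m i ω ^ p) μ := by
    intro m p i
    refine (hM p m i).1.mono' ?_ (Eventually.of_forall fun ω => ?_)
    · have := hmeas m i
      exact (by fun_prop : Measurable (fun ω => W m i ω ^ p)).aestronglyMeasurable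
    · simp
  have hXb : ∀ m (p : ℕ) i, |∫ ω, W m i ω ^ p ∂μ| ≤ M p := by
    intro m p i
    refine abs_integral_le_integral_abs.trans ?_
    simpa [abs_pow] using (hM p m i).2
  induction p using Nat.strong_induction_on with
  | _ p ih =>
  match p, ih with
  | 0, _ => exact ⟨1, by simp, fun m s => by simp⟩
  | 1, _ =>
    refine ⟨0, le_rfl, fun m s => ?_⟩
    simp only [pow_one]
    rw [integral_finsetSum _ fun i _ => by simpa using hX m 1 i]
    simp [h0]
  | p + 2, ih =>
    choose! C hC0 hC using ih
    set K : ℝ := ∑ k ∈ Finset.range (p + 1), M (k + 2) * C (p - k) *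
      ((p + 2).choose (k + 2) : ℝ) with hK
    have hK0 : 0 ≤ K := Finset.sum_nonneg fun k _ => by
      have := hM0 (k + 2)
      have := hC0 (p - k) (by omega)
      positivity
    refine ⟨K, hK0, fun m s => ?_⟩
    rw [show (p + 2) / 2 = p / 2 + 1 by omega]
    induction s using Finset.induction_on with
    | empty => simp
    | insert a s ha ihs =>
      rw [aux_step (hmeas m) (hindep m) (hX m) (h0 m) s a ha p, Finset.card_insert_of_notMem ha]
      push_cast
      have hb : |∑ k ∈ Finset.range (p + 1), (∫ ω, W m a ω ^ (k + 2) ∂μ) *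
        (∫ ω, (∑ i ∈ s, W m i ω) ^ (p - k) ∂μ) * ((p + 2).choose (k + 2) : ℝ)| ≤
          K * ((s.card : ℝ) + 1) ^ (p / 2) := by
        refine (Finset.abs_sum_le_sum_abs _ _).trans ?_
        rw [hK, Finset.sum_mul]
        refine Finset.sum_le_sum fun k _ => ?_
        rw [abs_mul, abs_mul, Nat.abs_cast]
        have e1 := hXb m (k + 2) a
        have e2 : |∫ ω, (∑ i ∈ s, W m i ω) ^ (p - k) ∂μ| ≤
            C (p - k) * ((s.card : ℝ) + 1) ^ (p / 2) := by
          refine (hC (p - k) (by omega) m s).trans ?_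
          refine mul_le_mul_of_nonneg_left ?_ (hC0 (p - k) (by omega))
          calc (s.card : ℝ) ^ ((p - k) / 2) ≤ ((s.card : ℝ) + 1) ^ ((p - k) / 2) := by
                gcongr; linarith
            _ ≤ _ := pow_le_pow_right₀ (by linarith [Nat.cast_nonneg (α := ℝ) s.card])
                (Nat.div_le_div_right (by omega))
        calc _ ≤ M (k + 2) * (C (p - k) * ((s.card : ℝ) + 1) ^ (p / 2)) *
              ((p + 2).choose (k + 2) : ℝ) := by
              gcongr
              exact hM0 _
          _ = _ := by ring
      refine (abs_add_le _ _).trans ?_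
      have e3 : (s.card : ℝ) ^ (p / 2 + 1) ≤ s.card * ((s.card : ℝ) + 1) ^ (p / 2) := by
        rw [pow_succ']
        gcongr
        linarith
      have e4 := mul_le_mul_of_nonneg_left e3 hK0
      calc _ ≤ K * ((s.card : ℝ) + 1) ^ (p / 2) +
            K * (s.card * ((s.card : ℝ) + 1) ^ (p / 2)) := by linarith
        _ = _ := by ring

lemma aux_tail (W : (m : ℕ) → Fin m → Ω → ℝ)
    (hmeas : ∀ m i, Measurable (W m i))
    (hindep : ∀ m, iIndepFun (W m) μ)
    (M : ℕ → ℝ) (hM0 : ∀ p, 0 ≤ M p)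
    (hM : ∀ p m (i : Fin m),
      Integrable (fun ω => |W m i ω| ^ p) μ ∧ (∫ ω, |W m i ω| ^ p ∂μ) ≤ M p)
    (h0 : ∀ m (i : Fin m), (∫ ω, W m i ω ∂μ) = 0) (k : ℕ) (t : ℝ) (ht : 0 < t) :
    ∃ C : ℝ, 0 ≤ C ∧ ∀ m, 0 < m → ∀ (s : Finset (Fin m)),
      μ.real {ω | (m : ℝ) * t < |∑ i ∈ s, W m i ω|} ≤ C / (m : ℝ) ^ k := by
  obtain ⟨C, hC0, hC⟩ := aux_main W hmeas hindep M hM0 hM h0 (2 * k)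
  have hX : ∀ m (p : ℕ) i, Integrable (fun ω => W m i ω ^ p) μ := by
    intro m p i
    refine (hM p m i).1.mono' ?_ (Eventually.of_forall fun ω => ?_)
    · have := hmeas m i
      exact (by fun_prop : Measurable (fun ω => W m i ω ^ p)).aestronglyMeasurable
    · simp
  refine ⟨C / t ^ (2 * k), by positivity, fun m hm s => ?_⟩
  have hm' : (0:ℝ) < m := by exact_mod_cast hm
  have hS := aux_int (hmeas m) (hindep m) (hX m) s (2 * k)
  have h1 := mul_meas_ge_le_integral_of_nonneg (μ := μ)
    (f := fun ω => (∑ i ∈ s, W m i ω) ^ (2 * k))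
    (Eventually.of_forall fun ω => by
      simp only [Pi.zero_apply]; rw [pow_mul]; positivity) hS (((m:ℝ) * t) ^ (2 * k))
  have h2 : μ.real {ω | (m : ℝ) * t < |∑ i ∈ s, W m i ω|} ≤
      μ.real {ω | ((m:ℝ) * t) ^ (2 * k) ≤ (∑ i ∈ s, W m i ω) ^ (2 * k)} := by
    refine measureReal_mono fun ω hω => ?_
    simp only [Set.mem_ofPred_eq] at hω ⊢
    rw [← (even_two_mul k).pow_abs (∑ i ∈ s, W m i ω)]
    gcongr
  have h3 : (s.card : ℝ) ≤ m := by
    have := s.card_le_univ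
    rw [Fintype.card_fin] at this
    exact_mod_cast this
  have h4 : ∫ ω, (∑ i ∈ s, W m i ω) ^ (2 * k) ∂μ ≤ C * (m:ℝ) ^ k := by
    refine (le_abs_self _).trans ((hC m s).trans ?_)
    rw [Nat.mul_div_cancel_left k two_pos]
    gcongr
  have hpos : 0 < ((m:ℝ) * t) ^ (2 * k) := by positivity
  have h5 : μ.real {ω | (m : ℝ) * t < |∑ i ∈ s, W m i ω|} ≤
      C * (m:ℝ) ^ k / ((m:ℝ) * t) ^ (2 * k) := by
    rw [le_div_iff₀ hpos, mul_comm]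
    exact (mul_le_mul_of_nonneg_left h2 hpos.le).trans (h1.trans h4)
  refine h5.trans (le_of_eq ?_)
  field_simp
  ring

end

lemma aux_lim (f : ℕ → ℝ) (hf : ∀ m, 0 ≤ f m) (C q : ℝ) (k : ℕ) (hk : q + 1 ≤ k) (hC0 : 0 ≤ C)
    (h : ∀ m : ℕ, 0 < m → f m ≤ m * (C / (m:ℝ) ^ k)) :
    Tendsto (fun m : ℕ => f m / (m:ℝ) ^ ((1:ℝ) - q)) atTop (nhds 0) := by
  refine tendsto_of_tendsto_of_tendsto_of_le_of_le' tendsto_const_nhds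
    (tendsto_const_div_atTop_nhds_zero_nat C) ?_ ?_
  · exact Eventually.of_forall fun m => div_nonneg (hf m) (by positivity)
  · filter_upwards [eventually_gt_atTop 0] with m hm
    have hm' : (0:ℝ) < m := by exact_mod_cast hm
    have hm1 : (1:ℝ) ≤ m := by exact_mod_cast hm
    rw [div_le_iff₀ (by positivity)]
    refine (h m hm).trans ?_
    have : (m:ℝ) * (m:ℝ) ≤ (m:ℝ) ^ ((1:ℝ) - q) * (m:ℝ) ^ k := by
      rw [← Real.rpow_natCast (m:ℝ) k, ← Real.rpow_add hm']
      calc (m:ℝ) * m = (m:ℝ) ^ (2:ℝ) := by rw [Real.rpow_two]; ring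
        _ ≤ _ := Real.rpow_le_rpow_of_exponent_le hm1 (by linarith)
    rw [mul_div_assoc', div_le_iff₀ (by positivity), div_mul_eq_mul_div, div_mul_eq_mul_div,
      le_div_iff₀ hm']
    nlinarith [mul_le_mul_of_nonneg_left this hC0]

/-- for a triangular array of independent random variables with uniformly bounded
`(q+ϵ)`-th moments for every `ϵ > 0` (`q ≥ 2`): if in addition the variables are mean-zero then
(a) `P(|Σ_i W_i| > mt) = o(m^{1−q})` and (b) `P(sup_j |Σ_{i≠j} W_i| > mt) = o(m^{1−q})` for
every `t > 0`; and (c) without the mean-zero assumption,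
`sup_j Σ_{i≠j} W_i = O_P(m)`. -/
theorem stmt_7 {Ω : Type*} [MeasurableSpace Ω] (μ : Measure Ω) [IsProbabilityMeasure μ]
    (W : (m : ℕ) → Fin m → Ω → ℝ)
    (hmeas : ∀ m i, Measurable (W m i))
    (hindep : ∀ m, iIndepFun (W m) μ)
    (q : ℝ) (hq : 2 ≤ q)
    (hmom : ∀ ϵ > (0:ℝ), ∃ C : ℝ, ∀ m (i : Fin m),
      Integrable (fun ω => |W m i ω| ^ (q + ϵ)) μ ∧
      (∫ ω, |W m i ω| ^ (q + ϵ) ∂μ) ≤ C) :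
    ((∀ m (i : Fin m), Integrable (W m i) μ ∧ (∫ ω, W m i ω ∂μ) = 0) →
      ∀ t > (0:ℝ),
        Tendsto (fun m : ℕ =>
            (μ {ω | (m : ℝ) * t < |∑ i, W m i ω|}).toReal / (m : ℝ) ^ ((1:ℝ) - q))
          atTop (nhds 0) ∧
        Tendsto (fun m : ℕ =>
            (μ {ω | (m : ℝ) * t <
                ⨆ j : Fin m, |∑ i ∈ Finset.univ.erase j, W m i ω|}).toReal /
              (m : ℝ) ^ ((1:ℝ) - q))
          atTop (nhds 0)) ∧
    (∀ ε > (0:ℝ), ∃ C > (0:ℝ), ∀ᶠ m : ℕ in atTop,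
      (μ {ω | C * (m : ℝ) <
          |⨆ j : Fin m, ∑ i ∈ Finset.univ.erase j, W m i ω|}).toReal ≤ ε) := by
  choose M hM0 hM using aux_mom μ W hmeas q hq hmom
  refine ⟨fun hz t ht => ?_, fun ε hε => ?_⟩
  · obtain ⟨k, hk⟩ := exists_nat_ge (q + 1)
    obtain ⟨C, hC0, hC⟩ := aux_tail W hmeas hindep M hM0 hM (fun m i => (hz m i).2) k t ht
    refine ⟨aux_lim _ (fun m => ENNReal.toReal_nonneg) C q k hk hC0 fun m hm => ?_,
      aux_lim _ (fun m => ENNReal.toReal_nonneg) C q k hk hC0 fun m hm => ?_⟩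
    · have h1 : (1:ℝ) ≤ m := by exact_mod_cast hm
      refine (hC m hm Finset.univ).trans ?_
      exact le_mul_of_one_le_left (by positivity) h1
    · have : Nonempty (Fin m) := ⟨⟨0, hm⟩⟩
      have hsub : {ω | (m : ℝ) * t < ⨆ j : Fin m, |∑ i ∈ Finset.univ.erase j, W m i ω|} ⊆
          ⋃ j : Fin m, {ω | (m : ℝ) * t < |∑ i ∈ Finset.univ.erase j, W m i ω|} := by
        intro ω hω
        simp only [Set.mem_ofPred_eq] at hω
        obtain ⟨j, hj⟩ := exists_lt_of_lt_ciSup hω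
        exact Set.mem_iUnion.2 ⟨j, hj⟩
      calc _ ≤ μ.real (⋃ j : Fin m,
            {ω | (m : ℝ) * t < |∑ i ∈ Finset.univ.erase j, W m i ω|}) := measureReal_mono hsub
        _ ≤ ∑ j : Fin m, μ.real {ω | (m : ℝ) * t < |∑ i ∈ Finset.univ.erase j, W m i ω|} :=
            measureReal_iUnion_fintype_le _
        _ ≤ ∑ j : Fin m, C / (m:ℝ) ^ k := Finset.sum_le_sum fun j _ => hC m hm _
        _ = _ := by simp
  · refine ⟨(M 1 + 1) / ε, by have := hM0 1; positivity, ?_⟩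
    filter_upwards [eventually_gt_atTop 0] with m hm
    have hm' : (0:ℝ) < m := by exact_mod_cast hm
    have : Nonempty (Fin m) := ⟨⟨0, hm⟩⟩
    have hI : ∀ i, Integrable (fun ω => |W m i ω|) μ := fun i => by simpa using (hM 1 m i).1
    have hb : ∀ i, ∫ ω, |W m i ω| ∂μ ≤ M 1 := fun i => by simpa using (hM 1 m i).2
    have hS : Integrable (fun ω => ∑ i, |W m i ω|) μ := integrable_finsetSum _ fun i _ => hI i
    have hpos : 0 < (M 1 + 1) / ε * m := by have := hM0 1; positivity
    have h1 := mul_meas_ge_le_integral_of_nonneg (μ := μ) (f := fun ω => ∑ i, |W m i ω|)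
      (Eventually.of_forall fun ω => Finset.sum_nonneg fun i _ => abs_nonneg _) hS
      ((M 1 + 1) / ε * m)
    have h2 : ∫ ω, ∑ i, |W m i ω| ∂μ ≤ m * M 1 := by
      rw [integral_finsetSum _ fun i _ => hI i]
      refine (Finset.sum_le_sum fun i _ => hb i).trans ?_
      simp
    have h3 : μ.real {ω | (M 1 + 1) / ε * (m : ℝ) <
          |⨆ j : Fin m, ∑ i ∈ Finset.univ.erase j, W m i ω|} ≤
        μ.real {ω | (M 1 + 1) / ε * (m : ℝ) ≤ ∑ i, |W m i ω|} := by
      refine measureReal_mono fun ω hω => ?_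
      simp only [Set.mem_ofPred_eq] at hω ⊢
      refine hω.le.trans ?_
      have hj : ∀ j : Fin m, |∑ i ∈ Finset.univ.erase j, W m i ω| ≤ ∑ i, |W m i ω| := fun j =>
        (Finset.abs_sum_le_sum_abs _ _).trans
          (Finset.sum_le_sum_of_subset_of_nonneg (Finset.erase_subset _ _)
            fun i _ _ => abs_nonneg _)
      rw [abs_le]
      refine ⟨?_, ciSup_le fun j => (abs_le.1 (hj j)).2⟩
      exact (abs_le.1 (hj ⟨0, hm⟩)).1.trans
        (le_ciSup (f := fun j : Fin m => ∑ i ∈ Finset.univ.erase j, W m i ω)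
          (Set.finite_range _).bddAbove ⟨0, hm⟩)
    refine h3.trans ?_
    refine le_of_mul_le_mul_left ((h1.trans h2).trans ?_) hpos
    have : (M 1 + 1) / ε * m * ε = m * (M 1 + 1) := by field_simp
    rw [this]
    nlinarith
end

section
/- Fix γ, k ∈ (0,1). For z = (x,y) ∈ ℝ^d × {0,1} let l(β;z) = log[q·(1−γ)^y γ^{1−y} + (1−q)·(1−γ^k)^y γ^{k(1−y)}] with q = (1+e^{−xᵀβ})^{−1}, let β* ∈ ℝ^d be fixed, and set S_j* = −Σ_{i≠j}∇²l(β*; z_i). Assume the z_i are independent and q ≥ 2. Then for every t > 0, as m → ∞: (a) if sup_i E‖x_i‖^{2q+ϵ} < ∞ for every ϵ > 0, then sup_{1≤j≤m} P(‖S_j*/m − E[S_j*/m]‖ > t) = o(m^{1−q}); (b) if sup_i E‖x_i‖^{3q+ϵ} < ∞ for every ϵ > 0, then sup_{1≤j≤m} P(|m^{−1}Σ_{i≠j}‖x_i‖³ − E[m^{−1}Σ_{i≠j}‖x_i‖³]| > t) = o(m^{1−q}); (c) if sup_i E‖x_i‖^{4q+ϵ} < ∞ for every ϵ > 0, then sup_{1≤j≤m}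 P(|m^{−1}Σ_{i≠j}‖x_i‖⁴ − E[m^{−1}Σ_{i≠j}‖x_i‖⁴]| > t) = o(m^{1−q}). -/
open MeasureTheory ProbabilityTheory Filter
open scoped BigOperators

noncomputable section

/-- The Hessian matrix `∇²f(β)` of `f : ℝ^d → ℝ`. -/
def hessMat {d : ℕ} (f : EuclideanSpace ℝ (Fin d) → ℝ) (β : EuclideanSpace ℝ (Fin d)) :
    Matrix (Fin d) (Fin d) ℝ :=
  Matrix.of fun i j =>
    iteratedFDeriv ℝ 2 f β ![EuclideanSpace.single i 1, EuclideanSpace.single j 1]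

/-- The spectral norm of a square real matrix. -/
def specNorm {d : ℕ} (M : Matrix (Fin d) (Fin d) ℝ) : ℝ :=
  ⨆ w : {w : EuclideanSpace ℝ (Fin d) // ‖w‖ = 1},
    ‖(EuclideanSpace.equiv (Fin d) ℝ).symm (M.mulVec (fun i => w.1 i))‖

/-- `S_j* = −Σ_{i≠j} ∇²l(β*; z_i)`. -/
def Sstar {Ω : Type*} {d : ℕ} (γ k : ℝ) (x : ℕ → Ω → EuclideanSpace ℝ (Fin d))
    (y : ℕ → Ω → ℝ) (βstar : EuclideanSpace ℝ (Fin d)) (m : ℕ) (j : Fin m) (ω : Ω) :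
    Matrix (Fin d) (Fin d) ℝ :=
  -∑ i ∈ Finset.univ.erase j, hessMat (lfun γ k (x i.1 ω) (y i.1 ω)) βstar

theorem core_tail {Ω ι : Type*} [MeasurableSpace Ω] (μ : Measure Ω) [IsProbabilityMeasure μ]
    (X : ι → Ω → ℝ) (hX : ∀ i, Measurable (X i)) (hind : iIndepFun X μ)
    (p C V L : ℝ) (hp : 0 ≤ p) (hL : 0 < L)
    (h1 : ∀ i, Integrable (X i) μ) (h0 : ∀ i, ∫ ω, X i ω ∂μ = 0)
    (h2 : ∀ i, Integrable (fun ω => X i ω ^ 2) μ) (hV : ∀ i, ∫ ω, X i ω ^ 2 ∂μ ≤ V)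
    (hpi : ∀ i, Integrable (fun ω => |X i ω| ^ p) μ) (hC : ∀ i, ∫ ω, |X i ω| ^ p ∂μ ≤ C)
    (s : Finset ι) (T : ℝ) :
    μ.real {ω | T < ∑ i ∈ s, X i ω} ≤
      s.card * (C / L ^ p) + Real.exp (-(T / L) + s.card * (2 * V / L ^ 2)) := by
  classical
  let φ : ℝ → ℝ := fun u => if |u| ≤ L then u else 0
  have hφm : Measurable φ :=
    Measurable.ite (measurableSet_le measurable_norm measurable_const) measurable_id measurable_const
  have hφL : ∀ u, |φ u| ≤ L := by
    intro u
    simp only [φ]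
    split_ifs with h
    · exact h
    · simpa using hL.le
  let Y : ι → Ω → ℝ := fun i => φ ∘ X i
  have hYm : ∀ i, Measurable (Y i) := fun i => hφm.comp (hX i)
  have hYind : iIndepFun Y μ := hind.comp (fun _ => φ) (fun _ => hφm)
  have hsub : {ω | T < ∑ i ∈ s, X i ω} ⊆
      (⋃ i ∈ s, {ω | L ^ p ≤ |X i ω| ^ p}) ∪ {ω | T ≤ (∑ i ∈ s, Y i) ω} := by
    intro ω hω
    by_cases hb : ∃ i ∈ s, L < |X i ω|
    · left
      obtain ⟨i, hi, hl⟩ := hb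
      simp only [Set.mem_iUnion]
      exact ⟨i, hi, Real.rpow_le_rpow hL.le hl.le hp⟩
    · right
      push Not at hb
      have : (∑ i ∈ s, Y i) ω = ∑ i ∈ s, X i ω := by
        rw [Finset.sum_apply]
        refine Finset.sum_congr rfl fun i hi => ?_
        simp [Y, φ, hb i hi]
      simp only [Set.mem_ofPred_eq, this] at hω ⊢
      exact hω.le
  have hA : μ.real (⋃ i ∈ s, {ω | L ^ p ≤ |X i ω| ^ p}) ≤ s.card * (C / L ^ p) := by
    refine (measureReal_biUnion_finset_le s _).trans ?_
    rw [← nsmul_eq_mul]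
    refine Finset.sum_le_card_nsmul _ _ _ fun i _ => ?_
    have := mul_meas_ge_le_integral_of_nonneg (μ := μ) (f := fun ω => |X i ω| ^ p)
      (Eventually.of_forall fun ω => by positivity) (hpi i) (L ^ p)
    rw [le_div_iff₀ (by positivity), mul_comm]
    exact this.trans (hC i)
  have hmgf : ∀ i, mgf (Y i) μ (1 / L) ≤ Real.exp (2 * V / L ^ 2) := by
    intro i
    have hpt : ∀ ω, Real.exp (1 / L * Y i ω) ≤ 1 + X i ω / L + 2 * (X i ω ^ 2) / L ^ 2 := by
      intro ω
      have hle : |1 / L * Y i ω| ≤ 1 := by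
        rw [abs_mul, abs_of_pos (by positivity : 0 < 1 / L), one_div, inv_mul_le_iff₀ hL]
        rw [mul_one]
        exact hφL (X i ω)
      by_cases hx : |X i ω| ≤ L
      · have hY : Y i ω = X i ω := by simp [Y, φ, hx]
        have := (abs_le.1 (Real.abs_exp_sub_one_sub_id_le hle)).2
        rw [hY] at this ⊢
        have e1 : (1 / L * X i ω) ^ 2 = X i ω ^ 2 / L ^ 2 := by field_simp
        have e2 : 1 / L * X i ω = X i ω / L := by field_simp
        have e3 : 0 ≤ X i ω ^ 2 / L ^ 2 := by positivity
        rw [e1] at this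
        rw [e2] at this ⊢
        rw [mul_div_assoc]
        linarith
      · have hY : Y i ω = 0 := by simp [Y, φ, hx]
        rw [hY]
        push Not at hx
        simp only [mul_zero, Real.exp_zero]
        have e1 : 1 ≤ |X i ω / L| := by
          rw [abs_div, abs_of_pos hL, le_div_iff₀ hL]; linarith
        have e2 : 2 * (X i ω ^ 2) / L ^ 2 = 2 * |X i ω / L| ^ 2 := by
          rw [sq_abs]; field_simp
        rw [e2]
        have := neg_abs_le (X i ω / L)
        nlinarith
    have hint : Integrable (fun ω => 1 + X i ω / L + 2 * (X i ω ^ 2) / L ^ 2) μ :=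
      (((integrable_const 1).add ((h1 i).div_const L))).add (((h2 i).const_mul 2).div_const _)
    have hle : mgf (Y i) μ (1 / L) ≤ ∫ ω, (1 + X i ω / L + 2 * (X i ω ^ 2) / L ^ 2) ∂μ :=
      integral_mono_of_nonneg (Eventually.of_forall fun ω => (Real.exp_pos _).le) hint
        (Eventually.of_forall hpt)
    have hval : ∫ ω, (1 + X i ω / L + 2 * (X i ω ^ 2) / L ^ 2) ∂μ
        = 1 + 2 * (∫ ω, X i ω ^ 2 ∂μ) / L ^ 2 := by
      have i1 : Integrable (fun ω => 1 + X i ω / L) μ :=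
        (integrable_const 1).add ((h1 i).div_const L)
      rw [integral_add i1
        (((h2 i).const_mul 2).div_const _), integral_add (integrable_const 1) ((h1 i).div_const L),
        integral_div, integral_div, integral_const_mul, h0 i]
      simp
    rw [hval] at hle
    have h3 : 2 * (∫ ω, X i ω ^ 2 ∂μ) / L ^ 2 ≤ 2 * V / L ^ 2 := by
      have := hV i
      gcongr
    have := Real.add_one_le_exp (2 * V / L ^ 2)
    linarith
  have hB : μ.real {ω | T ≤ (∑ i ∈ s, Y i) ω} ≤
      Real.exp (-(T / L) + s.card * (2 * V / L ^ 2)) := by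
    have hint : Integrable (fun ω => Real.exp (1 / L * (∑ i ∈ s, Y i) ω)) μ := by
      refine Integrable.of_bound ?_ (Real.exp (1 / L * (s.card * L))) ?_
      · simp only [Finset.sum_apply]
        exact (Real.measurable_exp.comp
          ((Finset.measurable_sum s fun i _ => hYm i).const_mul _)).aestronglyMeasurable
      · refine Eventually.of_forall fun ω => ?_
        rw [Real.norm_eq_abs, Real.abs_exp]
        gcongr
        rw [Finset.sum_apply, ← nsmul_eq_mul]
        exact Finset.sum_le_card_nsmul _ _ _ fun i _ => (le_abs_self _).trans (hφL _)
    refine (measure_ge_le_exp_mul_mgf T (by positivity) hint).trans ?_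
    rw [hYind.mgf_sum hYm, Real.exp_add, mul_comm (s.card : ℝ), mul_comm _ (s.card : ℝ),
      Real.exp_nat_mul]
    have : ∏ i ∈ s, mgf (Y i) μ (1 / L) ≤ Real.exp (2 * V / L ^ 2) ^ s.card :=
      (Finset.prod_le_prod (fun i _ => mgf_nonneg) (fun i _ => hmgf i)).trans (by simp)
    have e : -(1 / L) * T = -(T / L) := by ring
    rw [e]
    gcongr
  calc _ ≤ μ.real ((⋃ i ∈ s, {ω | L ^ p ≤ |X i ω| ^ p}) ∪ {ω | T ≤ (∑ i ∈ s, Y i) ω}) :=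
        measureReal_mono hsub
    _ ≤ _ := (measureReal_union_le _ _).trans (add_le_add hA hB)

/-- deterministic asymptotics -/
theorem asymp (q C V t : ℝ) (hq : 2 ≤ q) (ht : 0 < t) (hC : 0 ≤ C) (hV : 0 ≤ V) :
    Tendsto (fun m : ℕ => 2 * ((m : ℝ) * (C / ((m : ℝ) ^ ((q + 1 / 2) / (q + 1))) ^ (q + 1)) +
      Real.exp (-(t * m / (m : ℝ) ^ ((q + 1 / 2) / (q + 1))) +
        m * (2 * V / ((m : ℝ) ^ ((q + 1 / 2) / (q + 1))) ^ 2))) / (m : ℝ) ^ (1 - q))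
      atTop (nhds 0) := by
  set b : ℝ := (1 / 2) / (q + 1) with hb
  have hbpos : 0 < b := by rw [hb]; positivity
  have hab : (q + 1 / 2) / (q + 1) = 1 - b := by rw [hb]; field_simp; ring
  have hb4 : b ≤ 1 / 2 := by rw [hb, div_le_iff₀ (by linarith)]; nlinarith
  have hbq : (1 - b) * (q + 1) = q + 1 / 2 := by rw [hb]; field_simp; ring
  rw [hab]
  have T1 : Tendsto (fun m : ℕ => (m : ℝ) ^ (-(1 / 2 : ℝ))) atTop (nhds 0) :=
    (tendsto_rpow_neg_atTop (by norm_num)).comp tendsto_natCast_atTop_atTop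
  have T2 : Tendsto (fun m : ℕ => ((m : ℝ) ^ b) ^ ((q - 1) / b) * Real.exp (-t * (m : ℝ) ^ b))
      atTop (nhds 0) :=
    (tendsto_rpow_mul_exp_neg_mul_atTop_nhds_zero ((q - 1) / b) t ht).comp
      ((tendsto_rpow_atTop hbpos).comp tendsto_natCast_atTop_atTop)
  have T3 := (T1.const_mul (2 * C)).add (T2.const_mul (2 * Real.exp (2 * V)))
  simp only [mul_zero, add_zero] at T3
  refine squeeze_zero' (Eventually.of_forall fun m => by positivity) ?_ T3
  filter_upwards [eventually_ge_atTop 1] with m hm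
  have hm1 : (1 : ℝ) ≤ m := by exact_mod_cast hm
  have hm0 : (0 : ℝ) < m := by linarith
  generalize (m : ℝ) = x at hm1 hm0
  have e1 : (x ^ (1 - b)) ^ (q + 1) = x ^ (q + 1 / 2) := by
    rw [← Real.rpow_mul hm0.le, hbq]
  have e2 : t * x / x ^ (1 - b) = t * x ^ b := by
    rw [mul_div_assoc]
    congr 1
    rw [div_eq_iff (by positivity), ← Real.rpow_add hm0]
    simp
  have e3 : x * (2 * V / (x ^ (1 - b)) ^ 2) ≤ 2 * V := by
    have : x ≤ (x ^ (1 - b)) ^ 2 := by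
      rw [← Real.rpow_natCast, ← Real.rpow_mul hm0.le]
      calc x = x ^ (1 : ℝ) := by simp
        _ ≤ _ := Real.rpow_le_rpow_of_exponent_le hm1 (by push_cast; linarith)
    rw [← mul_div_assoc, div_le_iff₀ (by positivity)]
    nlinarith
  have e4 : (x ^ b) ^ ((q - 1) / b) = x ^ (q - 1) := by
    rw [← Real.rpow_mul hm0.le]; congr 1; field_simp
  have e5 : x ^ (1 - q) = (x ^ (q - 1))⁻¹ := by
    rw [← Real.rpow_neg hm0.le]; congr 1; ring
  have e6 : x * (C / x ^ (q + 1 / 2)) * x ^ (q - 1) = C * x ^ (-(1 / 2 : ℝ)) := by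
    rw [Real.rpow_neg hm0.le]
    have : x ^ (q + 1 / 2) = x * x ^ (q - 1) * x ^ (1 / 2 : ℝ) := by
      conv_rhs => rw [← Real.rpow_one_add' hm0.le (by linarith), ← Real.rpow_add hm0]
      congr 1; ring
    rw [this]
    field_simp
  rw [e1, e2, e4, e5, div_inv_eq_mul]
  have e7 : Real.exp (-(t * x ^ b) + x * (2 * V / (x ^ (1 - b)) ^ 2)) ≤
      Real.exp (2 * V) * Real.exp (-t * x ^ b) := by
    rw [← Real.exp_add]
    refine Real.exp_le_exp.2 ?_
    linarith
  calc _ = 2 * (x * (C / x ^ (q + 1 / 2)) * x ^ (q - 1)) + 2 * Real.exp (-(t * x ^ b) +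
        x * (2 * V / (x ^ (1 - b)) ^ 2)) * x ^ (q - 1) := by ring
    _ ≤ 2 * (x * (C / x ^ (q + 1 / 2)) * x ^ (q - 1)) +
        2 * (Real.exp (2 * V) * Real.exp (-t * x ^ b)) * x ^ (q - 1) := by gcongr
    _ = _ := by rw [e6]; ring

theorem gen_tail {Ω : Type*} [MeasurableSpace Ω] (μ : Measure Ω) [IsProbabilityMeasure μ]
    (U : ℕ → Ω → ℝ) (hU : ∀ i, Measurable (U i)) (hind : iIndepFun U μ)
    (q C : ℝ) (hq : 2 ≤ q)
    (hC : ∀ i, Integrable (fun ω => |U i ω| ^ (q + 1)) μ ∧ ∫ ω, |U i ω| ^ (q + 1) ∂μ ≤ C)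
    (t : ℝ) (ht : 0 < t) :
    Tendsto (fun m : ℕ =>
        (⨆ j : Fin m, (μ {ω |
            t < |(m : ℝ)⁻¹ * ∑ i ∈ Finset.univ.erase j, U i.1 ω -
              ∫ ω', (m : ℝ)⁻¹ * ∑ i ∈ Finset.univ.erase j, U i.1 ω' ∂μ|}).toReal) /
          (m : ℝ) ^ ((1:ℝ) - q)) atTop (nhds 0) := by
  have hle1 : ∀ u : ℝ, |u| ≤ 1 + |u| ^ (q + 1) := by
    intro u
    rcases le_total |u| 1 with h | h
    · have : 0 ≤ |u| ^ (q + 1) := by positivity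
      linarith
    · have := Real.rpow_le_rpow_of_exponent_le h (by linarith : (1 : ℝ) ≤ q + 1)
      rw [Real.rpow_one] at this
      linarith
  have hle2 : ∀ u : ℝ, u ^ 2 ≤ 1 + |u| ^ (q + 1) := by
    intro u
    rw [← sq_abs]
    rcases le_total |u| 1 with h | h
    · have : 0 ≤ |u| ^ (q + 1) := by positivity
      have h0 := abs_nonneg u
      nlinarith
    · have := Real.rpow_le_rpow_of_exponent_le h (by linarith : (2 : ℝ) ≤ q + 1)
      rw [Real.rpow_two] at this
      linarith
  have hUint : ∀ i, Integrable (U i) μ := fun i =>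
    ((integrable_const (1 : ℝ)).add (hC i).1).mono' (hU i).aestronglyMeasurable
      (Eventually.of_forall fun ω => hle1 _)
  have hC0 : 0 ≤ C := (integral_nonneg fun ω => by positivity).trans (hC 0).2
  have hmean : ∀ i, |∫ ω, U i ω ∂μ| ≤ 1 + C := by
    intro i
    calc |∫ ω, U i ω ∂μ| ≤ ∫ ω, (1 + |U i ω| ^ (q + 1)) ∂μ := by
          refine norm_integral_le_of_norm_le (f := U i) ((integrable_const (1 : ℝ)).add (hC i).1)
            (Eventually.of_forall fun ω => hle1 (U i ω))
      _ = 1 + ∫ ω, |U i ω| ^ (q + 1) ∂μ := by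
          rw [integral_add (integrable_const _) (hC i).1]; simp
      _ ≤ _ := by linarith [(hC i).2]
  let X : ℕ → Ω → ℝ := fun i ω => U i ω - ∫ ω', U i ω' ∂μ
  have hXm : ∀ i, Measurable (X i) := fun i => (hU i).sub_const _
  have hXind : iIndepFun X μ :=
    hind.comp (fun i u => u - ∫ ω', U i ω' ∂μ) (fun i => measurable_id.sub_const _)
  have hX1 : ∀ i, Integrable (X i) μ := fun i => (hUint i).sub (integrable_const _)
  have hX0 : ∀ i, ∫ ω, X i ω ∂μ = 0 := by
    intro i
    simp only [X]
    rw [integral_sub (hUint i) (integrable_const _)]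
    simp
  have hXb : ∀ i ω, |X i ω| ^ (q + 1) ≤ 2 ^ (q + 1) * (|U i ω| ^ (q + 1) + (1 + C) ^ (q + 1)) := by
    intro i ω
    have h1 : |X i ω| ≤ 2 * max |U i ω| (1 + C) := by
      have := abs_sub (U i ω) (∫ ω', U i ω' ∂μ)
      have := hmean i
      have := le_max_left |U i ω| (1 + C)
      have := le_max_right |U i ω| (1 + C)
      simp only [X]
      linarith
    have hmx : 0 ≤ max |U i ω| (1 + C) := le_max_of_le_left (abs_nonneg _)
    calc |X i ω| ^ (q + 1) ≤ (2 * max |U i ω| (1 + C)) ^ (q + 1) :=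
          Real.rpow_le_rpow (abs_nonneg _) h1 (by linarith)
      _ = 2 ^ (q + 1) * (max |U i ω| (1 + C)) ^ (q + 1) := Real.mul_rpow (by norm_num) hmx
      _ ≤ _ := by
          gcongr
          have a1 : 0 ≤ |U i ω| ^ (q + 1) := by positivity
          have a2 : 0 ≤ (1 + C) ^ (q + 1) := by positivity
          rcases max_choice |U i ω| (1 + C) with h | h <;> rw [h] <;> linarith
  have hbint : ∀ i, Integrable
      (fun ω => 2 ^ (q + 1) * (|U i ω| ^ (q + 1) + (1 + C) ^ (q + 1))) μ := fun i =>
    ((hC i).1.add (integrable_const _)).const_mul _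
  have hXp : ∀ i, Integrable (fun ω => |X i ω| ^ (q + 1)) μ := fun i =>
    (hbint i).mono' ((measurable_norm.comp (hXm i)).pow_const _).aestronglyMeasurable
      (Eventually.of_forall fun ω => by
        rw [Real.norm_eq_abs, abs_of_nonneg (by positivity)]; exact hXb i ω)
  set D : ℝ := 2 ^ (q + 1) * (C + (1 + C) ^ (q + 1)) with hD
  have hD0 : 0 ≤ D := by positivity
  have hXC : ∀ i, ∫ ω, |X i ω| ^ (q + 1) ∂μ ≤ D := by
    intro i
    refine (integral_mono (hXp i) (hbint i) (hXb i)).trans ?_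
    rw [integral_const_mul, integral_add (hC i).1 (integrable_const _)]
    have := (hC i).2
    simp only [integral_const, probReal_univ, one_smul, hD]
    gcongr
  have hX2 : ∀ i, Integrable (fun ω => X i ω ^ 2) μ := fun i =>
    ((integrable_const (1 : ℝ)).add (hXp i)).mono' ((hXm i).pow_const 2).aestronglyMeasurable
      (Eventually.of_forall fun ω => by
        rw [Real.norm_eq_abs, abs_of_nonneg (by positivity)]; exact hle2 _)
  have hXV : ∀ i, ∫ ω, X i ω ^ 2 ∂μ ≤ 1 + D := by
    intro i
    refine (integral_mono (hX2 i) ((integrable_const (1 : ℝ)).add (hXp i))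
      (fun ω => hle2 _)).trans ?_
    simp only [Pi.add_apply]
    rw [integral_add (integrable_const _) (hXp i)]
    simpa using hXC i
  refine squeeze_zero' (Eventually.of_forall fun m => ?_) ?_
    (asymp q D (1 + D) t hq ht hD0 (by linarith))
  · exact div_nonneg (Real.iSup_nonneg fun j => ENNReal.toReal_nonneg) (by positivity)
  filter_upwards [eventually_ge_atTop 1] with m hm
  have hm1 : (1 : ℝ) ≤ m := by exact_mod_cast hm
  have hm0 : (0 : ℝ) < m := by linarith
  refine div_le_div_of_nonneg_right ?_ (by positivity)
  refine Real.iSup_le (fun j => ?_) (by positivity)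
  set L : ℝ := (m : ℝ) ^ ((q + 1 / 2) / (q + 1)) with hLdef
  have hL : 0 < L := by positivity
  set s : Finset (Fin m) := Finset.univ.erase j with hs
  have hcard : (s.card : ℝ) ≤ m := by
    have : s.card ≤ m := (Finset.card_le_univ s).trans (by simp)
    exact_mod_cast this
  have hindF : iIndepFun (fun (i : Fin m) => X i.1) μ := hXind.precomp Fin.val_injective
  have hindN : iIndepFun (fun (i : Fin m) ω => - X i.1 ω) μ :=
    hindF.comp (fun _ u => -u) (fun _ => measurable_neg)
  have P1 := core_tail μ (fun i : Fin m => X i.1) (fun i => hXm _) hindF (q + 1) D (1 + D) L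
    (by linarith) hL (fun i => hX1 _) (fun i => hX0 _) (fun i => hX2 _) (fun i => hXV _)
    (fun i => hXp _) (fun i => hXC _) s (t * m)
  have P2 := core_tail μ (fun (i : Fin m) ω => - X i.1 ω) (fun i => (hXm _).neg) hindN
    (q + 1) D (1 + D) L (by linarith) hL (fun i => (hX1 _).neg)
    (fun i => by rw [integral_neg, hX0, neg_zero])
    (fun i => by simpa using hX2 i) (fun i => by simpa using hXV i)
    (fun i => by simpa using hXp i) (fun i => by simpa using hXC i) s (t * m)
  have hsum : ∀ ω, (m : ℝ)⁻¹ * ∑ i ∈ s, U i.1 ω - ∫ ω', (m : ℝ)⁻¹ * ∑ i ∈ s, U i.1 ω' ∂μ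
      = (m : ℝ)⁻¹ * ∑ i ∈ s, X i.1 ω := by
    intro ω
    rw [integral_const_mul, integral_finsetSum _ (fun i _ => hUint i.1)]
    simp only [X, Finset.sum_sub_distrib]
    ring
  have hsub : {ω | t < |(m : ℝ)⁻¹ * ∑ i ∈ s, U i.1 ω -
      ∫ ω', (m : ℝ)⁻¹ * ∑ i ∈ s, U i.1 ω' ∂μ|} ⊆
      {ω | t * m < ∑ i ∈ s, X i.1 ω} ∪ {ω | t * m < ∑ i ∈ s, - X i.1 ω} := by
    intro ω hω
    simp only [Set.mem_ofPred_eq] at hω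
    rw [hsum, abs_mul, abs_of_pos (by positivity : 0 < (m : ℝ)⁻¹), lt_inv_mul_iff₀ hm0,
      mul_comm, lt_abs] at hω
    simpa [Finset.sum_neg_distrib] using hω
  have hbound : (s.card : ℝ) * (D / L ^ (q + 1)) +
      Real.exp (-(t * m / L) + s.card * (2 * (1 + D) / L ^ 2)) ≤
      m * (D / L ^ (q + 1)) + Real.exp (-(t * m / L) + m * (2 * (1 + D) / L ^ 2)) := by
    gcongr
  have := (measureReal_mono (μ := μ) hsub).trans (measureReal_union_le _ _)
  change μ.real _ ≤ _
  linarith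

theorem hess_formula {d : ℕ} (A B : ℝ) (hA : 0 < A) (hB : 0 < B)
    (x β : EuclideanSpace ℝ (Fin d)) (a b : Fin d) :
    hessMat (fun β => Real.log ((1 + Real.exp (-dotp x β))⁻¹ * A
      + (1 - (1 + Real.exp (-dotp x β))⁻¹) * B)) β a b =
    (A * B * Real.exp (-dotp x β) / (A + B * Real.exp (-dotp x β)) ^ 2
      - Real.exp (-dotp x β) / (1 + Real.exp (-dotp x β)) ^ 2) * (x a * x b) := by
  let Λ : EuclideanSpace ℝ (Fin d) →L[ℝ] ℝ :=
    LinearMap.toContinuousLinearMap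
      { toFun := dotp x
        map_add' := fun u v => by simp [dotp, mul_add, Finset.sum_add_distrib]
        map_smul' := fun c v => by simp [dotp, Finset.mul_sum, mul_left_comm] }
  have hΛ : ∀ v, Λ v = dotp x v := fun v => rfl
  let g : ℝ → ℝ := fun s => Real.log ((1 + Real.exp (-s))⁻¹ * A + (1 - (1 + Real.exp (-s))⁻¹) * B)
  let g1 : ℝ → ℝ := fun s => Real.exp (-s) / (1 + Real.exp (-s)) -
    B * Real.exp (-s) / (A + B * Real.exp (-s))
  have hE : ∀ s : ℝ, HasDerivAt (fun s => Real.exp (-s)) (-Real.exp (-s)) s := fun s => by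
    simpa using (hasDerivAt_neg s).exp
  have hg : ∀ s, HasDerivAt g (g1 s) s := by
    intro s
    have hgeq : g = fun s => Real.log (A + B * Real.exp (-s)) - Real.log (1 + Real.exp (-s)) := by
      funext s
      have := Real.exp_pos (-s)
      rw [← Real.log_div (by positivity) (by positivity)]
      simp only [g]
      congr 1
      field_simp
      ring
    rw [hgeq]
    have := Real.exp_pos (-s)
    have h1 := (((hE s).const_mul B).const_add A).log (by positivity)
    have h2 := ((hE s).const_add 1).log (by positivity)
    refine HasDerivAt.congr_deriv (h1.sub h2) ?_
    simp only [g1]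
    ring
  have hg1 : ∀ s, HasDerivAt g1 (A * B * Real.exp (-s) / (A + B * Real.exp (-s)) ^ 2
      - Real.exp (-s) / (1 + Real.exp (-s)) ^ 2) s := by
    intro s
    have := Real.exp_pos (-s)
    have h1 := ((hE s).const_mul B).div (((hE s).const_mul B).const_add A) (by positivity)
    have h2 := (hE s).div ((hE s).const_add 1) (by positivity)
    refine HasDerivAt.congr_deriv (h2.sub h1) ?_
    field_simp
    ring
  have hf : (fun β => Real.log ((1 + Real.exp (-dotp x β))⁻¹ * A
      + (1 - (1 + Real.exp (-dotp x β))⁻¹) * B)) = fun β => g (Λ β) := rfl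
  have hfd : fderiv ℝ (fun β => g (Λ β)) = fun β => g1 (Λ β) • Λ := by
    funext v
    exact ((hg (Λ v)).comp_hasFDerivAt v Λ.hasFDerivAt).fderiv
  have hsingle : ∀ i, Λ (EuclideanSpace.single i 1) = x i := by
    intro i
    rw [hΛ]
    simp [dotp]
  rw [hf]
  simp only [hessMat, Matrix.of_apply]
  have hfd2 := (((hg1 (Λ β)).comp_hasFDerivAt β Λ.hasFDerivAt).smul_const Λ).fderiv
  simp only [Function.comp_apply] at hfd2
  rw [iteratedFDeriv_two_apply, hfd, hfd2]
  simp only [Matrix.cons_val_zero, Matrix.cons_val_one, ContinuousLinearMap.smulRight_apply,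
    _root_.smul_apply, smul_eq_mul, hsingle, hΛ]
  ring

theorem hess_coef_bound (A B E : ℝ) (hA : 0 < A) (hB : 0 < B) (hE : 0 < E) :
    |A * B * E / (A + B * E) ^ 2 - E / (1 + E) ^ 2| ≤ 1 := by
  have h1 : 0 ≤ A * B * E / (A + B * E) ^ 2 := by positivity
  have h2 : 0 ≤ E / (1 + E) ^ 2 := by positivity
  have h3 : A * B * E / (A + B * E) ^ 2 ≤ 1 := by
    rw [div_le_one (by positivity)]
    nlinarith [mul_pos hA (mul_pos hB hE), sq_nonneg A, sq_nonneg (B * E)]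
  have h4 : E / (1 + E) ^ 2 ≤ 1 := by
    rw [div_le_one (by positivity)]
    nlinarith
  rw [abs_le]
  constructor <;> linarith

theorem specNorm_le {d : ℕ} (M : Matrix (Fin d) (Fin d) ℝ) :
    specNorm M ≤ ∑ a, ∑ b, |M a b| := by
  refine Real.iSup_le (fun w => ?_) (by positivity)
  have hw : ∀ b, |w.1 b| ≤ 1 := fun b => by
    have := PiLp.norm_apply_le w.1 b
    rwa [w.2] at this
  have hn : ∀ v : EuclideanSpace ℝ (Fin d), ‖v‖ ≤ ∑ a, |v a| := by
    intro v
    rw [EuclideanSpace.norm_eq]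
    refine Real.sqrt_le_iff.2 ⟨by positivity, ?_⟩
    simpa using Finset.sum_sq_le_sq_sum_of_nonneg (s := Finset.univ) (f := fun a => |v a|)
      (fun a _ => abs_nonneg _)
  refine (hn _).trans (Finset.sum_le_sum fun a _ => ?_)
  change |∑ b, M a b * w.1 b| ≤ _
  refine (Finset.abs_sum_le_sum_abs _ _).trans (Finset.sum_le_sum fun b _ => ?_)
  rw [abs_mul]
  exact mul_le_of_le_one_right (abs_nonneg _) (hw b)


/-- uniform-in-`j` tail bounds of order `o(m^{1−q})` for (a) `‖S_j*/m − E S_j*/m‖`,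
(b) `|m⁻¹Σ_{i≠j}‖x_i‖³ − E[·]|` and (c) `|m⁻¹Σ_{i≠j}‖x_i‖⁴ − E[·]|`, under the corresponding
moment conditions. -/
theorem stmt_8 {Ω : Type*} [MeasurableSpace Ω] (μ : Measure Ω) [IsProbabilityMeasure μ]
    {d : ℕ} (γ k : ℝ) (hγ : γ ∈ Set.Ioo (0:ℝ) 1) (hk : k ∈ Set.Ioo (0:ℝ) 1)
    (βstar : EuclideanSpace ℝ (Fin d))
    (x : ℕ → Ω → EuclideanSpace ℝ (Fin d)) (y : ℕ → Ω → ℝ)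
    (hxmeas : ∀ i, Measurable (x i)) (hymeas : ∀ i, Measurable (y i))
    (hy01 : ∀ i ω, y i ω = 0 ∨ y i ω = 1)
    (hindep : iIndepFun (fun i ω => (x i ω, y i ω)) μ)
    (q : ℝ) (hq : 2 ≤ q) :
    ((∀ ϵ > (0:ℝ), ∃ C : ℝ, ∀ i, Integrable (fun ω => ‖x i ω‖ ^ (2 * q + ϵ)) μ ∧
        (∫ ω, ‖x i ω‖ ^ (2 * q + ϵ) ∂μ) ≤ C) →
      ∀ t > (0:ℝ), Tendsto (fun m : ℕ =>
        (⨆ j : Fin m, (μ {ω | t < specNorm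
            (Matrix.of fun a b =>
              Sstar γ k x y βstar m j ω a b / m -
                ∫ ω', Sstar γ k x y βstar m j ω' a b / m ∂μ)}).toReal) /
          (m : ℝ) ^ ((1:ℝ) - q)) atTop (nhds 0)) ∧
    ((∀ ϵ > (0:ℝ), ∃ C : ℝ, ∀ i, Integrable (fun ω => ‖x i ω‖ ^ (3 * q + ϵ)) μ ∧
        (∫ ω, ‖x i ω‖ ^ (3 * q + ϵ) ∂μ) ≤ C) →
      ∀ t > (0:ℝ), Tendsto (fun m : ℕ =>
        (⨆ j : Fin m, (μ {ω |
            t < |(m : ℝ)⁻¹ * ∑ i ∈ Finset.univ.erase j, ‖x i.1 ω‖ ^ 3 -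
              ∫ ω', (m : ℝ)⁻¹ * ∑ i ∈ Finset.univ.erase j, ‖x i.1 ω'‖ ^ 3 ∂μ|}).toReal) /
          (m : ℝ) ^ ((1:ℝ) - q)) atTop (nhds 0)) ∧
    ((∀ ϵ > (0:ℝ), ∃ C : ℝ, ∀ i, Integrable (fun ω => ‖x i ω‖ ^ (4 * q + ϵ)) μ ∧
        (∫ ω, ‖x i ω‖ ^ (4 * q + ϵ) ∂μ) ≤ C) →
      ∀ t > (0:ℝ), Tendsto (fun m : ℕ =>
        (⨆ j : Fin m, (μ {ω |
            t < |(m : ℝ)⁻¹ * ∑ i ∈ Finset.univ.erase j, ‖x i.1 ω‖ ^ 4 -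
              ∫ ω', (m : ℝ)⁻¹ * ∑ i ∈ Finset.univ.erase j, ‖x i.1 ω'‖ ^ 4 ∂μ|}).toReal) /
          (m : ℝ) ^ ((1:ℝ) - q)) atTop (nhds 0)) := by
  classical
  refine ⟨fun h t ht => ?_, fun h t ht => ?_, fun h t ht => ?_⟩
  · obtain ⟨C, hC⟩ := h 2 (by norm_num)
    let A : ℝ → ℝ := fun y => (1 - γ) ^ y * γ ^ (1 - y)
    let B : ℝ → ℝ := fun y => (1 - γ ^ k) ^ y * γ ^ (k * (1 - y))
    have hγ0 := hγ.1
    have hγ1 : 0 < 1 - γ := by linarith [hγ.2]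
    have hγk : 0 < 1 - γ ^ k := by
      have := Real.rpow_lt_one hγ.1.le hγ.2 hk.1
      linarith
    have hA : ∀ y, 0 < A y := fun y => by simp only [A]; positivity
    have hB : ∀ y, 0 < B y := fun y => by simp only [B]; positivity
    have hAm : Measurable A := by simp only [A]; fun_prop
    have hBm : Measurable B := by simp only [B]; fun_prop
    let E : EuclideanSpace ℝ (Fin d) → ℝ := fun x => Real.exp (-dotp x βstar)
    have hEm : Measurable E := by simp only [E, dotp]; fun_prop
    have hE : ∀ x, 0 < E x := fun x => Real.exp_pos _
    let H : Fin d → Fin d → EuclideanSpace ℝ (Fin d) × ℝ → ℝ := fun a b z =>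
      -((A z.2 * B z.2 * E z.1 / (A z.2 + B z.2 * E z.1) ^ 2 - E z.1 / (1 + E z.1) ^ 2)
        * (z.1 a * z.1 b))
    have hHm : ∀ a b, Measurable (H a b) := by
      intro a b
      have m1 : Measurable (fun z : EuclideanSpace ℝ (Fin d) × ℝ => A z.2) :=
        hAm.comp measurable_snd
      have m2 : Measurable (fun z : EuclideanSpace ℝ (Fin d) × ℝ => B z.2) :=
        hBm.comp measurable_snd
      have m3 : Measurable (fun z : EuclideanSpace ℝ (Fin d) × ℝ => E z.1) :=
        hEm.comp measurable_fst
      have m4 : ∀ a, Measurable (fun z : EuclideanSpace ℝ (Fin d) × ℝ => z.1 a) := fun a => by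
        fun_prop
      exact (((((m1.mul m2).mul m3).div ((m1.add (m2.mul m3)).pow_const 2)).sub
        (m3.div ((measurable_const.add m3).pow_const 2))).mul ((m4 a).mul (m4 b))).neg
    have hHb : ∀ a b z, |H a b z| ≤ ‖z.1‖ ^ 2 := by
      intro a b z
      simp only [H]
      rw [abs_neg, abs_mul, abs_mul]
      have h1 := hess_coef_bound (A z.2) (B z.2) (E z.1) (hA _) (hB _) (hE _)
      have h2 : |z.1 a| ≤ ‖z.1‖ := PiLp.norm_apply_le z.1 a
      have h3 : |z.1 b| ≤ ‖z.1‖ := PiLp.norm_apply_le z.1 b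
      calc _ ≤ 1 * (‖z.1‖ * ‖z.1‖) := by gcongr
        _ = _ := by ring
    let U : Fin d → Fin d → ℕ → Ω → ℝ := fun a b i ω => H a b (x i ω, y i ω)
    have hS : ∀ m (j : Fin m) ω a b, Sstar γ k x y βstar m j ω a b / m =
        (m : ℝ)⁻¹ * ∑ i ∈ Finset.univ.erase j, U a b i.1 ω := by
      intro m j ω a b
      rw [div_eq_inv_mul]
      congr 1
      simp only [Sstar, Matrix.neg_apply, Matrix.sum_apply]
      rw [← Finset.sum_neg_distrib]
      refine Finset.sum_congr rfl fun i _ => ?_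
      exact congrArg Neg.neg (hess_formula (A (y i.1 ω)) (B (y i.1 ω)) (hA _) (hB _)
        (x i.1 ω) βstar a b)
    have hUm : ∀ a b i, Measurable (U a b i) := fun a b i =>
      (hHm a b).comp ((hxmeas i).prodMk (hymeas i))
    have hUind : ∀ a b, iIndepFun (U a b) μ := fun a b =>
      hindep.comp (fun _ => H a b) (fun _ => hHm a b)
    have hUp : ∀ a b i ω, |U a b i ω| ^ (q + 1) ≤ ‖x i ω‖ ^ (2 * q + 2) := by
      intro a b i ω
      calc |U a b i ω| ^ (q + 1) ≤ (‖x i ω‖ ^ 2) ^ (q + 1) :=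
            Real.rpow_le_rpow (abs_nonneg _) (hHb a b _) (by linarith)
        _ = _ := by
            rw [← Real.rpow_natCast, ← Real.rpow_mul (norm_nonneg _)]
            congr 1
            push_cast
            ring
    have hUC : ∀ a b i, Integrable (fun ω => |U a b i ω| ^ (q + 1)) μ ∧
        ∫ ω, |U a b i ω| ^ (q + 1) ∂μ ≤ C := by
      intro a b i
      have hi : Integrable (fun ω => |U a b i ω| ^ (q + 1)) μ :=
        (hC i).1.mono' ((measurable_norm.comp (hUm a b i)).pow_const _).aestronglyMeasurable
          (Eventually.of_forall fun ω => by
            rw [Real.norm_eq_abs, abs_of_nonneg (by positivity)]; exact hUp a b i ω)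
      exact ⟨hi, (integral_mono hi (hC i).1 (hUp a b i)).trans (hC i).2⟩
    let t' : ℝ := t / (d * d + 1)
    have ht' : 0 < t' := by simp only [t']; positivity
    have hT : Tendsto (fun m : ℕ => ∑ a, ∑ b, (⨆ j : Fin m, (μ {ω |
            t' < |(m : ℝ)⁻¹ * ∑ i ∈ Finset.univ.erase j, U a b i.1 ω -
              ∫ ω', (m : ℝ)⁻¹ * ∑ i ∈ Finset.univ.erase j, U a b i.1 ω' ∂μ|}).toReal) /
          (m : ℝ) ^ ((1:ℝ) - q)) atTop (nhds 0) := by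
      have := tendsto_finsetSum (Finset.univ : Finset (Fin d)) (fun a _ =>
        tendsto_finsetSum (Finset.univ : Finset (Fin d)) (fun b _ =>
          gen_tail μ (U a b) (hUm a b) (hUind a b) q C hq (hUC a b) t' ht'))
      simpa using this
    refine squeeze_zero (fun m => ?_) (fun m => ?_) hT
    · exact div_nonneg (Real.iSup_nonneg fun j => ENNReal.toReal_nonneg) (by positivity)
    simp only [← Finset.sum_div]
    refine div_le_div_of_nonneg_right ?_ (by positivity)
    refine Real.iSup_le (fun j => ?_) (Finset.sum_nonneg fun a _ => Finset.sum_nonneg fun b _ =>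
      Real.iSup_nonneg fun j => ENNReal.toReal_nonneg)
    let W : Fin d → Fin d → Fin m → Set Ω := fun a b j => {ω |
            t' < |(m : ℝ)⁻¹ * ∑ i ∈ Finset.univ.erase j, U a b i.1 ω -
              ∫ ω', (m : ℝ)⁻¹ * ∑ i ∈ Finset.univ.erase j, U a b i.1 ω' ∂μ|}
    have hsub : {ω | t < specNorm (Matrix.of fun a b => Sstar γ k x y βstar m j ω a b / m -
                ∫ ω', Sstar γ k x y βstar m j ω' a b / m ∂μ)} ⊆
        ⋃ a ∈ (Finset.univ : Finset (Fin d)), ⋃ b ∈ (Finset.univ : Finset (Fin d)), W a b j := by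
      intro ω hω
      by_contra hn
      simp only [Set.mem_iUnion, not_exists, Finset.mem_univ, true_imp_iff] at hn
      have hω' : t < specNorm (Matrix.of fun a b => Sstar γ k x y βstar m j ω a b / m -
                ∫ ω', Sstar γ k x y βstar m j ω' a b / m ∂μ) := hω
      have h1 := hω'.trans_le (specNorm_le _)
      simp only [Matrix.of_apply, hS] at h1
      have h2 : t < ∑ a : Fin d, ∑ b : Fin d, t' :=
        h1.trans_le (Finset.sum_le_sum fun a _ => Finset.sum_le_sum fun b _ =>
          not_lt.1 (hn a b))
      simp only [Finset.sum_const, Finset.card_univ, Fintype.card_fin, nsmul_eq_mul] at h2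
      have h3 : t' * (d * d + 1) = t := by simp only [t']; field_simp
      nlinarith
    change μ.real _ ≤ _
    refine (measureReal_mono hsub (measure_ne_top μ _)).trans ((measureReal_biUnion_finset_le _ _).trans
      (Finset.sum_le_sum fun a _ => (measureReal_biUnion_finset_le _ _).trans
        (Finset.sum_le_sum fun b _ => ?_)))
    exact le_ciSup (f := fun j => μ.real (W a b j)) (Set.finite_range _).bddAbove j
  · obtain ⟨C, hC⟩ := h 3 (by norm_num)
    refine gen_tail μ (fun i ω => ‖x i ω‖ ^ 3) (fun i => (hxmeas i).norm.pow_const 3)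
      (hindep.comp (fun _ z => ‖z.1‖ ^ 3) (fun _ => measurable_fst.norm.pow_const 3))
      q C hq (fun i => ?_) t ht
    have e : ∀ ω, |‖x i ω‖ ^ 3| ^ (q + 1) = ‖x i ω‖ ^ (3 * q + 3) := fun ω => by
      rw [abs_of_nonneg (by positivity), ← Real.rpow_natCast, ← Real.rpow_mul (norm_nonneg _)]
      congr 1
      push_cast
      ring
    simp only [e]
    exact hC i
  · obtain ⟨C, hC⟩ := h 4 (by norm_num)
    refine gen_tail μ (fun i ω => ‖x i ω‖ ^ 4) (fun i => (hxmeas i).norm.pow_const 4)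
      (hindep.comp (fun _ z => ‖z.1‖ ^ 4) (fun _ => measurable_fst.norm.pow_const 4))
      q C hq (fun i => ?_) t ht
    have e : ∀ ω, |‖x i ω‖ ^ 4| ^ (q + 1) = ‖x i ω‖ ^ (4 * q + 4) := fun ω => by
      rw [abs_of_nonneg (by positivity), ← Real.rpow_natCast, ← Real.rpow_mul (norm_nonneg _)]
      congr 1
      push_cast
      ring
    simp only [e]
    exact hC i
end
end

section
/- Fix γ, k ∈ (0,1). Let x be a real random variable whose distribution is symmetric about zero with P(x ≠ 0) > 0 and E x² < ∞, and define L(β) = E[ (1−γ)·log{1−γ + (γ−γ^k)·e^{−xβ}/(1+e^{−xβ})} + γ·log{γ − (γ−γ^k)·e^{−xβ}/(1+e^{−xβ})} ] for β ∈ ℝ. Then L is differentiable with L'(0) = 0, L'(β) > 0 for β < 0, L'(β) < 0 for β > 0, and L'(β) = −L'(−β) for all β; consequently β* = 0 is the unique global maximizer of L over ℝ. -/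
open MeasureTheory

lemma aux_gen {Ω : Type*} [MeasurableSpace Ω] (μ : Measure Ω) [IsProbabilityMeasure μ]
    (x : Ω → ℝ) (hx : Measurable x)
    (hsymm : Measure.map x μ = Measure.map (fun ω => -x ω) μ)
    (hne : 0 < μ {ω | x ω ≠ 0})
    (hmom : Integrable (fun ω => (x ω) ^ 2) μ)
    (G h : ℝ → ℝ) (C : ℝ) (hG : ∀ t, HasDerivAt G (h t) t) (hh : Continuous h)
    (hC : ∀ t, |h t| ≤ C) (hlt : ∀ t, 0 < t → h t < h (-t))
    (L : ℝ → ℝ) (hL : ∀ β, L β = ∫ ω, G (x ω * β) ∂μ) :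
    (∀ β, DifferentiableAt ℝ L β) ∧
    deriv L 0 = 0 ∧
    (∀ β < (0:ℝ), 0 < deriv L β) ∧
    (∀ β > (0:ℝ), deriv L β < 0) ∧
    (∀ β, deriv L β = -deriv L (-β)) ∧
    (∀ β, L β ≤ L 0) ∧
    (∀ β, L β = L 0 → β = 0) := by
  have hGc : Continuous G := continuous_iff_continuousAt.2 fun t => (hG t).continuousAt
  have hxi : Integrable x μ := by
    have : MemLp x 2 μ := (memLp_two_iff_integrable_sq hx.aestronglyMeasurable).2 hmom
    exact this.integrable (by norm_num)
  have hGm : ∀ β, AEStronglyMeasurable (fun ω => G (x ω * β)) μ := fun β =>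
    (hGc.measurable.comp (hx.mul_const β)).aestronglyMeasurable
  have hhm : ∀ β, AEStronglyMeasurable (fun ω => x ω * h (x ω * β)) μ := fun β =>
    (hx.mul (hh.measurable.comp (hx.mul_const β))).aestronglyMeasurable
  have hGb : ∀ t, |G t| ≤ |G 0| + C * |t| := by
    intro t
    have := Convex.norm_image_sub_le_of_norm_hasDerivWithin_le (f := G) (f' := h) (C := C)
      (s := Set.univ) (x := 0) (y := t) (fun s _ => (hG s).hasDerivWithinAt)
      (fun s _ => hC s) convex_univ (Set.mem_univ _) (Set.mem_univ _)
    simp only [Real.norm_eq_abs, sub_zero] at this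
    have h2 := abs_sub_abs_le_abs_sub (G t) (G 0)
    linarith
  have hGi : ∀ β, Integrable (fun ω => G (x ω * β)) μ := by
    intro β
    have hi : Integrable (fun ω => |G 0| + C * |x ω * β|) μ :=
      (integrable_const _).add ((hxi.mul_const β).abs.const_mul C)
    exact hi.mono' (hGm β) (Filter.Eventually.of_forall fun ω => hGb _)
  have hb : Integrable (fun ω => C * |x ω|) μ := hxi.abs.const_mul C
  have hbd : ∀ ω β, ‖x ω * h (x ω * β)‖ ≤ C * |x ω| := by
    intro ω β
    rw [Real.norm_eq_abs, abs_mul, mul_comm]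
    exact mul_le_mul_of_nonneg_right (hC _) (abs_nonneg _)
  have hhi : ∀ β, Integrable (fun ω => x ω * h (x ω * β)) μ := fun β =>
    hb.mono' (hhm β) (Filter.Eventually.of_forall fun ω => hbd ω β)
  have hLe : L = fun β => ∫ ω, G (x ω * β) ∂μ := funext hL
  have hD : ∀ β, HasDerivAt L (∫ ω, x ω * h (x ω * β) ∂μ) β := by
    intro β
    rw [hLe]
    refine (hasDerivAt_integral_of_dominated_loc_of_deriv_le (s := Set.univ)
      (F := fun β ω => G (x ω * β)) (F' := fun β ω => x ω * h (x ω * β))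
      (bound := fun ω => C * |x ω|) Filter.univ_mem
      (Filter.Eventually.of_forall hGm) (hGi β) (hhm β)
      (Filter.Eventually.of_forall fun ω b _ => hbd ω b) hb
      (Filter.Eventually.of_forall fun ω b _ => ?_)).2
    have h1 : HasDerivAt (fun b => x ω * b) (x ω) b := by
      simpa using (hasDerivAt_id b).const_mul (x ω)
    have := (hG (x ω * b)).comp b h1
    rw [mul_comm]
    exact this
  have heven : ∀ β, L (-β) = L β := by
    intro β
    rw [hL, hL]
    have hc : Continuous fun t => G (t * β) := by fun_prop
    have h1 := integral_map (μ := μ) hx.aemeasurable (f := fun t => G (t * β))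
      hc.aestronglyMeasurable
    have h2 := integral_map (μ := μ) hx.neg.aemeasurable (f := fun t => G (t * β))
      hc.aestronglyMeasurable
    have h3 : Measure.map (-x) μ = Measure.map x μ := hsymm.symm
    rw [h3, h1] at h2
    rw [h2]
    simp
  have hodd : ∀ β, deriv L β = -deriv L (-β) := by
    intro β
    have := deriv_comp_neg (f := L) (x := β)
    rw [← this]
    congr 1
    exact (funext heven).symm
  have hneg : ∀ β > (0:ℝ), deriv L β < 0 := by
    intro β hβ
    have hpt : ∀ ω, x ω ≠ 0 → 0 < x ω * h (x ω * -β) - x ω * h (x ω * β) := by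
      intro ω h0
      rcases lt_or_gt_of_ne h0 with h0 | h0
      · have := hlt (x ω * -β) (by nlinarith)
        rw [mul_neg, neg_neg] at this
        rw [mul_neg]
        nlinarith
      · have := hlt (x ω * β) (by positivity)
        rw [mul_neg]
        nlinarith
    have hpos : 0 < ∫ ω, (x ω * h (x ω * -β) - x ω * h (x ω * β)) ∂μ := by
      refine (integral_pos_iff_support_of_nonneg ?_ ((hhi (-β)).sub (hhi β))).2 ?_
      rotate_left
      · refine hne.trans_le (measure_mono fun ω hω => ?_)
        exact (hpt ω hω).ne'
      · intro ω
        by_cases h0 : x ω = 0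
        · simp [h0]
        · exact (hpt ω h0).le
    rw [integral_sub (hhi _) (hhi _), ← (hD _).deriv, ← (hD _).deriv] at hpos
    have := hodd β
    linarith
  have hanti : StrictAntiOn L (Set.Ici 0) := by
    apply strictAntiOn_of_deriv_neg (convex_Ici 0)
    · exact fun b _ => (hD b).continuousAt.continuousWithinAt
    · intro b hb
      rw [interior_Ici] at hb
      exact hneg b hb
  have habs : ∀ β, L |β| = L β := by
    intro β
    rcases abs_choice β with h | h <;> rw [h]
    exact heven β
  have hmax : ∀ β, β ≠ 0 → L β < L 0 := by
    intro β hβ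
    rw [← habs β]
    exact hanti (by simp) (by simp) (abs_pos.2 hβ)
  refine ⟨fun β => (hD β).differentiableAt, ?_, ?_, hneg, hodd, ?_, ?_⟩
  · have := hodd 0
    rw [neg_zero] at this
    linarith
  · intro β hβ
    have := hneg (-β) (by linarith)
    rw [hodd]
    linarith
  · intro β
    by_cases h0 : β = 0
    · rw [h0]
    · exact (hmax β h0).le
  · intro β h
    by_contra h0
    exact (hmax β h0).ne h

/-- for the population quasi log-likelihood `L` in the one-dimensional null case
with a covariate symmetric about zero, `L'(0) = 0`, `L' > 0` on `(−∞,0)`, `L' < 0` on `(0,∞)`,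
`L'` is odd, and `β* = 0` is the unique global maximizer of `L`. -/
theorem stmt_13 {Ω : Type*} [MeasurableSpace Ω] (μ : Measure Ω) [IsProbabilityMeasure μ]
    (γ k : ℝ) (hγ : γ ∈ Set.Ioo (0:ℝ) 1) (hk : k ∈ Set.Ioo (0:ℝ) 1)
    (x : Ω → ℝ) (hx : Measurable x)
    (hsymm : Measure.map x μ = Measure.map (fun ω => -x ω) μ)
    (hne : 0 < μ {ω | x ω ≠ 0})
    (hmom : Integrable (fun ω => (x ω) ^ 2) μ)
    (L : ℝ → ℝ)
    (hL : ∀ β, L β = ∫ ω,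
      ((1 - γ) * Real.log (1 - γ + (γ - γ ^ k) *
          (Real.exp (-(x ω * β)) / (1 + Real.exp (-(x ω * β)))))
        + γ * Real.log (γ - (γ - γ ^ k) *
          (Real.exp (-(x ω * β)) / (1 + Real.exp (-(x ω * β)))))) ∂μ) :
    (∀ β, DifferentiableAt ℝ L β) ∧
    deriv L 0 = 0 ∧
    (∀ β < (0:ℝ), 0 < deriv L β) ∧
    (∀ β > (0:ℝ), deriv L β < 0) ∧
    (∀ β, deriv L β = -deriv L (-β)) ∧
    (∀ β, L β ≤ L 0) ∧
    (∀ β, L β = L 0 → β = 0) := by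
  obtain ⟨hγ0, hγ1⟩ := hγ
  obtain ⟨hk0, hk1⟩ := hk
  have hc0 : γ < γ ^ k := by
    simpa using Real.rpow_lt_rpow_of_exponent_gt hγ0 hγ1 hk1
  have hc1 : γ ^ k < 1 := Real.rpow_lt_one hγ0.le hγ1 hk0
  generalize γ ^ k = d at *
  obtain ⟨u, hu⟩ : ∃ u : ℝ → ℝ, u = fun t => Real.exp (-t) / (1 + Real.exp (-t)) := ⟨_, rfl⟩
  have hu0 : ∀ t, 0 < u t := by intro t; rw [hu]; positivity
  have hu1 : ∀ t, u t < 1 := by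
    intro t; rw [hu]
    have := Real.exp_pos (-t)
    rw [div_lt_one (by positivity)]; linarith
  have hun : ∀ t, u (-t) = 1 - u t := by
    intro t; rw [hu]
    have := Real.exp_pos (-t)
    have := Real.exp_pos t
    have h3 : Real.exp (-t) * Real.exp t = 1 := by rw [← Real.exp_add]; simp
    simp only [neg_neg]
    field_simp
    linarith
  have hulow : ∀ t, 0 < t → u t < 1 / 2 := by
    intro t ht; rw [hu]
    have h1 := Real.exp_pos (-t)
    have h2 : Real.exp (-t) < 1 := by rw [Real.exp_lt_one_iff]; linarith
    rw [div_lt_div_iff₀ (by positivity) (by norm_num)]; linarith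
  have hud : ∀ t, HasDerivAt u (-(u t * (1 - u t))) t := by
    intro t; rw [hu]
    have h1 := Real.exp_pos (-t)
    have h2 : HasDerivAt (fun t => Real.exp (-t)) (-Real.exp (-t)) t := by
      simpa using (hasDerivAt_neg t).exp
    have h3 := h2.div (h2.const_add 1) (by positivity)
    refine h3.congr_deriv ?_
    field_simp
    ring
  have huc : Continuous u := continuous_iff_continuousAt.2 fun t => (hud t).continuousAt
  have hA : ∀ v, 0 < v → v < 1 → 1 - d < 1 - γ + (γ - d) * v := by
    intro v _ _; nlinarith
  have hB : ∀ v, 0 < v → v < 1 → γ < γ - (γ - d) * v := by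
    intro v _ _; nlinarith
  have hA' : ∀ t, 0 < 1 - γ + (γ - d) * u t := fun t => by
    have := hA _ (hu0 t) (hu1 t); linarith
  have hB' : ∀ t, 0 < γ - (γ - d) * u t := fun t => by
    have := hB _ (hu0 t) (hu1 t); linarith
  refine aux_gen μ x hx hsymm hne hmom
    (fun t => (1 - γ) * Real.log (1 - γ + (γ - d) * u t) + γ * Real.log (γ - (γ - d) * u t))
    (fun t => (γ - d) ^ 2 * (u t) ^ 2 * (1 - u t) /
      ((1 - γ + (γ - d) * u t) * (γ - (γ - d) * u t)))
    (1 / ((1 - d) * γ)) ?_ ?_ ?_ ?_ L ?_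
  · intro t
    have ha := hA' t
    have hb := hB' t
    have h1 := (((hud t).const_mul (γ - d)).const_add (1 - γ)).log ha.ne'
    have h2 := (((hud t).const_mul (γ - d)).const_sub γ).log hb.ne'
    refine ((h1.const_mul (1 - γ)).add (h2.const_mul γ)).congr_deriv ?_
    field_simp
    ring
  · refine Continuous.div (by fun_prop) (by fun_prop) fun t => (mul_pos (hA' t) (hB' t)).ne'
  · intro t
    have ha := hA' t
    have hb := hB' t
    have h0 := hu0 t
    have h1 := hu1 t
    have h2 : 0 < 1 - u t := by linarith
    have h3 : 0 < 1 - d := by linarith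
    rw [abs_of_nonneg (by positivity)]
    apply div_le_div₀ (by norm_num) _ (by positivity)
    · exact mul_le_mul (hA _ h0 h1).le (hB _ h0 h1).le hγ0.le ha.le
    · have e1 : (γ - d) ^ 2 ≤ 1 := by nlinarith
      have e2 : (u t) ^ 2 ≤ 1 := by nlinarith
      have e3 : (γ - d) ^ 2 * (u t) ^ 2 ≤ 1 := mul_le_one₀ e1 (by positivity) e2
      exact mul_le_one₀ e3 h2.le (by linarith)
  · intro t ht
    have ha := hA' t
    have hb := hB' t
    have ha2 := hA' (-t)
    have hb2 := hB' (-t)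
    have h0 := hu0 t
    have hl := hulow t ht
    simp only [hun] at ha2 hb2 ⊢
    generalize u t = v at *
    rw [div_lt_div_iff₀ (by positivity) (by positivity), ← sub_pos]
    have hd : 0 < (d - γ) ^ 2 := by have : 0 < d - γ := by linarith
                                    positivity
    have e1 : 0 < 1 - v := by linarith
    have e2 : 0 < 1 - 2 * v := by linarith
    have e3 : 0 < 1 - γ := by linarith
    have : 0 < (d - γ) ^ 2 * (v * (1 - v)) * ((1 - 2 * v) *
      ((1 - γ) * γ + (d - γ) ^ 2 * (v * (1 - v)))) := by positivity
    refine this.trans_eq ?_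
    ring
  · intro β
    rw [hL, hu]
end

section
/- Fix γ, k ∈ (0,1). Let x be a real random variable with E x² < ∞, distribution symmetric about zero, and define L(β) = E[ (1−γ)·log{1−γ + (γ−γ^k)·e^{−xβ}/(1+e^{−xβ})} + γ·log{γ − (γ−γ^k)·e^{−xβ}/(1+e^{−xβ})} ]. Then L is twice differentiable at 0 and L''(0) = −(γ−γ^k)²·u(γ,k)·E(x²)/32, where u(γ,k) = [2{1−γ+(γ−γ^k)/2}{γ−(γ−γ^k)/2} − (γ−γ^k)(γ+γ^k−1)] / [{1−γ+(γ−γ^k)/2}²{γ−(γ−γ^k)/2}²]. In particular, if u(γ,k) > 0 and E(x²) ≥ c' for some c' > 0, then L''(0) ≤ −c for some c > 0. -/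
open MeasureTheory

theorem aux_deriv {Ω : Type*} [MeasurableSpace Ω] (μ : Measure Ω)
    (x : Ω → ℝ) (hx : Measurable x) (n : ℕ)
    (h0 : Integrable (fun ω => (x ω) ^ n) μ) (h1 : Integrable (fun ω => (x ω) ^ (n + 1)) μ)
    (G G' : ℝ → ℝ) (hG : ∀ t, HasDerivAt G (G' t) t) (hc : Measurable G')
    (C C' : ℝ) (hC : ∀ t, |G t| ≤ C) (hC' : ∀ t, |G' t| ≤ C') (β : ℝ) :
    HasDerivAt (fun b => ∫ ω, x ω ^ n * G (x ω * b) ∂μ)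
      (∫ ω, x ω ^ (n + 1) * G' (x ω * β) ∂μ) β := by
  have hGm : Measurable G :=
    (continuous_iff_continuousAt.2 fun t => (hG t).continuousAt).measurable
  refine (hasDerivAt_integral_of_dominated_loc_of_deriv_le
    (F := fun b ω => x ω ^ n * G (x ω * b))
    (F' := fun b ω => x ω ^ (n + 1) * G' (x ω * b))
    (bound := fun ω => |x ω ^ (n + 1)| * C') (s := Set.univ) Filter.univ_mem ?_ ?_ ?_ ?_ ?_ ?_).2
  · refine Filter.Eventually.of_forall fun b => ?_
    exact ((hx.pow_const n).mul (hGm.comp (hx.mul_const b))).aestronglyMeasurable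
  · refine (h0.abs.mul_const C).mono'
      ((hx.pow_const n).mul (hGm.comp (hx.mul_const β))).aestronglyMeasurable ?_
    refine Filter.Eventually.of_forall fun ω => ?_
    simp only [Real.norm_eq_abs, abs_mul]
    exact mul_le_mul_of_nonneg_left (hC _) (abs_nonneg _)
  · exact ((hx.pow_const (n + 1)).mul (hc.comp (hx.mul_const β))).aestronglyMeasurable
  · refine Filter.Eventually.of_forall fun ω b _ => ?_
    simp only [Real.norm_eq_abs, abs_mul]
    exact mul_le_mul_of_nonneg_left (hC' _) (abs_nonneg _)
  · exact h1.abs.mul_const C'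
  · refine Filter.Eventually.of_forall fun ω b _ => ?_
    have h2 : HasDerivAt (fun b => x ω * b) (x ω) b := by
      simpa using (hasDerivAt_id b).const_mul (x ω)
    have := ((hG (x ω * b)).comp b h2).const_mul (x ω ^ n)
    refine this.congr_deriv ?_
    ring

theorem aux_s (t : ℝ) : HasDerivAt (fun t => Real.exp (-t) / (1 + Real.exp (-t)))
    (-((Real.exp (-t) / (1 + Real.exp (-t))) * (1 - Real.exp (-t) / (1 + Real.exp (-t))))) t := by
  have h1 : HasDerivAt (fun t => Real.exp (-t)) (-Real.exp (-t)) t := by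
    simpa using (hasDerivAt_neg t).exp
  have hp : 0 < 1 + Real.exp (-t) := by positivity
  refine (h1.div (h1.const_add 1) hp.ne').congr_deriv ?_
  field_simp
  ring

theorem aux_mem (t : ℝ) : Real.exp (-t) / (1 + Real.exp (-t)) ∈ Set.Icc (0:ℝ) 1 := by
  have hp := Real.exp_pos (-t)
  refine ⟨by positivity, ?_⟩
  rw [div_le_one (by positivity)]
  linarith

/-- second derivative at `0` of the population quasi log-likelihood in the
one-dimensional null case: `L''(0) = −(γ−γ^k)²·u(γ,k)·E(x²)/32`; in particular
if `u(γ,k) > 0` and `E(x²) ≥ c' > 0` then `L''(0) ≤ −c` for some `c > 0`. -/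
theorem stmt_14 {Ω : Type*} [MeasurableSpace Ω] (μ : Measure Ω) [IsProbabilityMeasure μ]
    (γ k : ℝ) (hγ : γ ∈ Set.Ioo (0:ℝ) 1) (hk : k ∈ Set.Ioo (0:ℝ) 1)
    (x : Ω → ℝ) (hx : Measurable x)
    (hsymm : Measure.map x μ = Measure.map (fun ω => -x ω) μ)
    (hmom : Integrable (fun ω => (x ω) ^ 2) μ)
    (L : ℝ → ℝ)
    (hL : ∀ β, L β = ∫ ω,
      ((1 - γ) * Real.log (1 - γ + (γ - γ ^ k) *
          (Real.exp (-(x ω * β)) / (1 + Real.exp (-(x ω * β)))))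
        + γ * Real.log (γ - (γ - γ ^ k) *
          (Real.exp (-(x ω * β)) / (1 + Real.exp (-(x ω * β)))))) ∂μ) :
    (∀ᶠ β in nhds (0:ℝ), DifferentiableAt ℝ L β) ∧
    DifferentiableAt ℝ (deriv L) 0 ∧
    deriv (deriv L) 0 =
      -((γ - γ ^ k) ^ 2 *
          ((2 * (1 - γ + (γ - γ ^ k) / 2) * (γ - (γ - γ ^ k) / 2)
              - (γ - γ ^ k) * (γ + γ ^ k - 1)) /
            ((1 - γ + (γ - γ ^ k) / 2) ^ 2 * (γ - (γ - γ ^ k) / 2) ^ 2)) *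
          (∫ ω, (x ω) ^ 2 ∂μ)) / 32 ∧
    (0 < (2 * (1 - γ + (γ - γ ^ k) / 2) * (γ - (γ - γ ^ k) / 2)
            - (γ - γ ^ k) * (γ + γ ^ k - 1)) /
          ((1 - γ + (γ - γ ^ k) / 2) ^ 2 * (γ - (γ - γ ^ k) / 2) ^ 2) →
      ∀ c' > (0:ℝ), c' ≤ ∫ ω, (x ω) ^ 2 ∂μ →
        ∃ c > (0:ℝ), deriv (deriv L) 0 ≤ -c) := by
  obtain ⟨hγ0, hγ1⟩ := hγ
  obtain ⟨hk0, hk1⟩ := hk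
  have hq1 : γ ^ k < 1 := Real.rpow_lt_one hγ0.le hγ1 hk0
  have hq : γ < γ ^ k := by
    have := Real.rpow_lt_rpow_of_exponent_gt hγ0 hγ1 hk1
    simpa using this
  generalize γ ^ k = q at *
  obtain ⟨d, hd⟩ : ∃ d, d = γ - q := ⟨_, rfl⟩
  rw [← hd] at hL
  have hA : ∀ s ∈ Set.Icc (0:ℝ) 1, 1 - γ + d * s ≠ 0 := by
    rintro s ⟨hs0, hs1⟩
    have : 0 < 1 - γ + d * s := by subst hd; nlinarith
    exact this.ne'
  have hB : ∀ s ∈ Set.Icc (0:ℝ) 1, γ - d * s ≠ 0 := by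
    rintro s ⟨hs0, hs1⟩
    have : 0 < γ - d * s := by subst hd; nlinarith
    exact this.ne'
  let S : ℝ → ℝ := fun t => Real.exp (-t) / (1 + Real.exp (-t))
  have hS : ∀ t, HasDerivAt S (-(S t * (1 - S t))) t := aux_s
  have hSm : ∀ t, S t ∈ Set.Icc (0:ℝ) 1 := aux_mem
  have hSc : Continuous S := continuous_iff_continuousAt.2 fun t => (hS t).continuousAt
  let g : ℝ → ℝ := fun s => (1 - γ) * Real.log (1 - γ + d * s) + γ * Real.log (γ - d * s)
  let g1 : ℝ → ℝ := fun s => -(s * (1 - s)) * (d * ((1 - γ) / (1 - γ + d * s) - γ / (γ - d * s)))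
  let g2 : ℝ → ℝ := fun s => -(s * (1 - s)) * ((-(1 - 2 * s)) * (d * ((1 - γ) / (1 - γ + d * s) - γ / (γ - d * s)))
    + (s * (1 - s)) * (d ^ 2 * ((1 - γ) / (1 - γ + d * s) ^ 2 + γ / (γ - d * s) ^ 2)))
  have hA' : ∀ s, HasDerivAt (fun s => 1 - γ + d * s) d s := fun s => by
    simpa using ((hasDerivAt_id s).const_mul d).const_add (1 - γ)
  have hB' : ∀ s, HasDerivAt (fun s => γ - d * s) (-d) s := fun s => by
    simpa using ((hasDerivAt_id s).const_mul d).const_sub γ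
  have hg : ∀ s ∈ Set.Icc (0:ℝ) 1, HasDerivAt g
      (d * ((1 - γ) / (1 - γ + d * s) - γ / (γ - d * s))) s := by
    intro s hs
    have h := (((hA' s).log (hA s hs)).const_mul (1 - γ)).add
      (((hB' s).log (hB s hs)).const_mul γ)
    refine h.congr_deriv ?_
    ring
  have hg1 : ∀ s ∈ Set.Icc (0:ℝ) 1, HasDerivAt g1
      ((-(1 - 2 * s)) * (d * ((1 - γ) / (1 - γ + d * s) - γ / (γ - d * s)))
    + (s * (1 - s)) * (d ^ 2 * ((1 - γ) / (1 - γ + d * s) ^ 2 + γ / (γ - d * s) ^ 2))) s := by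
    intro s hs
    have h1 : HasDerivAt (fun s : ℝ => -(s * (1 - s))) (-(1 - 2 * s)) s := by
      have := ((hasDerivAt_id s).mul ((hasDerivAt_id s).const_sub 1)).neg
      refine this.congr_deriv ?_
      simp only [id]; ring
    have h2 := ((((hasDerivAt_const s (1 - γ)).div (hA' s) (hA s hs)).sub
      ((hasDerivAt_const s γ).div (hB' s) (hB s hs))).const_mul d)
    refine (h1.mul h2).congr_deriv ?_
    have a := hA s hs
    have b := hB s hs
    simp only [Pi.sub_apply, Pi.div_apply]
    ring
  have hg2 : ContinuousOn g2 (Set.Icc 0 1) := by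
    have a2 : ∀ s ∈ Set.Icc (0:ℝ) 1, (1 - γ + d * s) ^ 2 ≠ 0 := fun s hs => pow_ne_zero 2 (hA s hs)
    have b2 : ∀ s ∈ Set.Icc (0:ℝ) 1, (γ - d * s) ^ 2 ≠ 0 := fun s hs => pow_ne_zero 2 (hB s hs)
    have c1 : ContinuousOn (fun s => (1 - γ) / (1 - γ + d * s)) (Set.Icc 0 1) :=
      ContinuousOn.div (by fun_prop) (by fun_prop) hA
    have c2 : ContinuousOn (fun s => γ / (γ - d * s)) (Set.Icc 0 1) :=
      ContinuousOn.div (by fun_prop) (by fun_prop) hB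
    have c3 : ContinuousOn (fun s => (1 - γ) / (1 - γ + d * s) ^ 2) (Set.Icc 0 1) :=
      ContinuousOn.div (by fun_prop) (by fun_prop) a2
    have c4 : ContinuousOn (fun s => γ / (γ - d * s) ^ 2) (Set.Icc 0 1) :=
      ContinuousOn.div (by fun_prop) (by fun_prop) b2
    have e1 : ContinuousOn (fun s : ℝ => -(s * (1 - s))) (Set.Icc 0 1) := by fun_prop
    have e2 : ContinuousOn (fun s : ℝ => -(1 - 2 * s)) (Set.Icc 0 1) := by fun_prop
    have e3 : ContinuousOn (fun s : ℝ => s * (1 - s)) (Set.Icc 0 1) := by fun_prop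
    exact e1.mul ((e2.mul (continuousOn_const.mul (c1.sub c2))).add
      (e3.mul (continuousOn_const.mul (c3.add c4))))
  have hgc : ContinuousOn g (Set.Icc 0 1) := fun s hs => (hg s hs).continuousAt.continuousWithinAt
  have hg1c : ContinuousOn g1 (Set.Icc 0 1) := fun s hs => (hg1 s hs).continuousAt.continuousWithinAt
  obtain ⟨C0, hC0⟩ := isCompact_Icc.exists_bound_of_continuousOn hgc
  obtain ⟨C1, hC1⟩ := isCompact_Icc.exists_bound_of_continuousOn hg1c
  obtain ⟨C2, hC2⟩ := isCompact_Icc.exists_bound_of_continuousOn hg2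
  have D0 : ∀ t, HasDerivAt (fun t => g (S t)) (g1 (S t)) t := fun t => by
    refine ((hg _ (hSm t)).comp t (hS t)).congr_deriv ?_
    simp only [g1]; ring
  have D1 : ∀ t, HasDerivAt (fun t => g1 (S t)) (g2 (S t)) t := fun t => by
    refine ((hg1 _ (hSm t)).comp t (hS t)).congr_deriv ?_
    simp only [g2]; ring
  have M1 : Measurable (fun t => g1 (S t)) := (hg1c.comp_continuous hSc hSm).measurable
  have M2 : Measurable (fun t => g2 (S t)) := (hg2.comp_continuous hSc hSm).measurable
  have i0 : Integrable (fun ω => (x ω) ^ 0) μ := by simp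
  have i1 : Integrable (fun ω => (x ω) ^ (0 + 1)) μ := by
    refine (hmom.add (integrable_const 1)).mono' (hx.pow_const _).aestronglyMeasurable ?_
    refine Filter.Eventually.of_forall fun ω => ?_
    simp only [Real.norm_eq_abs, zero_add, pow_one, Pi.add_apply]
    rw [abs_le]
    constructor <;> nlinarith [sq_nonneg (x ω - 1), sq_nonneg (x ω + 1)]
  have E0 := aux_deriv μ x hx 0 i0 i1 _ _ D0 M1 C0 C1
    (fun t => hC0 _ (hSm t)) (fun t => hC1 _ (hSm t))
  have E1 := aux_deriv μ x hx (0 + 1) i1 hmom _ _ D1 M2 C1 C2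
    (fun t => hC1 _ (hSm t)) (fun t => hC2 _ (hSm t))
  have hLe : L = fun b => ∫ ω, x ω ^ 0 * g (S (x ω * b)) ∂μ := by
    funext b
    rw [hL b]
    simp only [pow_zero, one_mul, g, S]
  rw [← hLe] at E0
  have hdL : deriv L = fun b => ∫ ω, x ω ^ (0 + 1) * g1 (S (x ω * b)) ∂μ :=
    funext fun b => (E0 b).deriv
  rw [← hdL] at E1
  have key : deriv (deriv L) 0 =
      -((γ - q) ^ 2 *
          ((2 * (1 - γ + (γ - q) / 2) * (γ - (γ - q) / 2)
              - (γ - q) * (γ + q - 1)) /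
            ((1 - γ + (γ - q) / 2) ^ 2 * (γ - (γ - q) / 2) ^ 2)) *
          (∫ ω, (x ω) ^ 2 ∂μ)) / 32 := by
    rw [(E1 0).deriv]
    have hS0 : S 0 = 1 / 2 := by simp only [S]; norm_num
    simp only [mul_zero, hS0]
    rw [integral_mul_const]
    have a := hA (1 / 2) (by norm_num)
    have b := hB (1 / 2) (by norm_num)
    have hv : g2 (1 / 2) = -((γ - q) ^ 2 *
          ((2 * (1 - γ + (γ - q) / 2) * (γ - (γ - q) / 2)
              - (γ - q) * (γ + q - 1)) /
            ((1 - γ + (γ - q) / 2) ^ 2 * (γ - (γ - q) / 2) ^ 2))) / 32 := by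
      have r1 : 1 - γ + (γ - q) / 2 = 1 - γ + d * (1 / 2) := by rw [hd]; ring
      have r2 : γ - (γ - q) / 2 = γ - d * (1 / 2) := by rw [hd]; ring
      have r3 : (1 - γ) / (1 - γ + d * (1 / 2)) ^ 2 + γ / (γ - d * (1 / 2)) ^ 2 =
          ((1 - γ) * (γ - d * (1 / 2)) ^ 2 + γ * (1 - γ + d * (1 / 2)) ^ 2) /
          ((1 - γ + d * (1 / 2)) ^ 2 * (γ - d * (1 / 2)) ^ 2) := by
        rw [div_add_div _ _ (pow_ne_zero 2 a) (pow_ne_zero 2 b)]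
        ring
      have r4 : (1 - γ) * (γ - d * (1 / 2)) ^ 2 + γ * (1 - γ + d * (1 / 2)) ^ 2 =
          (2 * (1 - γ + d * (1 / 2)) * (γ - d * (1 / 2)) - (γ - q) * (γ + q - 1)) / 2 := by
        rw [hd]; ring
      simp only [g2]
      rw [r3, r4, r1, r2, ← hd]
      ring
    rw [hv]
    norm_num
    ring
  refine ⟨Filter.Eventually.of_forall fun b => (E0 b).differentiableAt,
    (E1 0).differentiableAt, key, fun hu c' hc' hle => ?_⟩
  rw [key]
  have hE := hc'.trans_le hle
  have hd2 : 0 < (γ - q) ^ 2 := by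
    have : γ - q ≠ 0 := (sub_neg.2 hq).ne
    positivity
  refine ⟨_, div_pos (mul_pos (mul_pos hd2 hu) hE) (by norm_num : (0:ℝ) < 32), ?_⟩
  rw [neg_div]
end

section
/- Fix γ, k ∈ (0,1) and α > 0. Given p-values p_1,…,p_m and covariates x_1,…,x_m ∈ ℝ^d with at least one p_i > γ, let β̂ ∈ ℝ^d be arbitrary and set π̃(x_i) = (1+e^{−x_iᵀβ̂})^{−1}, τ̃ = k[Σ_i 1{p_i>γ}/(α(1−γ))·((1−π̃(x_i))/π̃(x_i))^{1/(1−k)}]^{1−k}, and t̂_i = [(1−π̃(x_i))k/(π̃(x_i)τ̃)]^{1/(1−k)} (i.e., the procedure with ε_1 = ε = 0, ε_2 = 1). Then t̂_i = α·w_i for every i, where w_i = e^{−x_iᵀβ̂/(1−k)} / [ Σ_{j=1}^m (1{p_j>γ}/(1−γ))·e^{−x_jᵀβ̂/(1−k)} ]; hence rejecting hypothesis i when p_i ≤ min(t̂_i, γ) is a weighted Bonferroni rule p_i ≤ min(α w_i, γ). -/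
open scoped BigOperators

noncomputable section

/-- Logistic estimate `π̃(x_i) = (1+e^{−x_iᵀβ̂})⁻¹`. -/
def piTilde {d m : ℕ} (x : Fin m → EuclideanSpace ℝ (Fin d))
    (βhat : EuclideanSpace ℝ (Fin d)) (i : Fin m) : ℝ :=
  (1 + Real.exp (-dotp (x i) βhat))⁻¹

/-- `τ̃ = k[Σ_i 1{p_i>γ}/(α(1−γ))·((1−π̃(x_i))/π̃(x_i))^{1/(1−k)}]^{1−k}`. -/
def tauTilde {d m : ℕ} (γ k α : ℝ) (p : Fin m → ℝ) (x : Fin m → EuclideanSpace ℝ (Fin d))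
    (βhat : EuclideanSpace ℝ (Fin d)) : ℝ :=
  k * (∑ i, (if γ < p i then (1:ℝ) else 0) / (α * (1 - γ)) *
      ((1 - piTilde x βhat i) / piTilde x βhat i) ^ (1 / (1 - k))) ^ (1 - k)

/-- Threshold `t̂_i = [(1−π̃(x_i))k/(π̃(x_i)τ̃)]^{1/(1−k)}`. -/
def tHat {d m : ℕ} (γ k α : ℝ) (p : Fin m → ℝ) (x : Fin m → EuclideanSpace ℝ (Fin d))
    (βhat : EuclideanSpace ℝ (Fin d)) (i : Fin m) : ℝ :=
  ((1 - piTilde x βhat i) * k / (piTilde x βhat i * tauTilde γ k α p x βhat)) ^ (1 / (1 - k))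

/-- Normalized exponential weight `w_i`. -/
def wProc {d m : ℕ} (γ k : ℝ) (p : Fin m → ℝ) (x : Fin m → EuclideanSpace ℝ (Fin d))
    (βhat : EuclideanSpace ℝ (Fin d)) (i : Fin m) : ℝ :=
  Real.exp (-(dotp (x i) βhat) / (1 - k)) /
    (∑ j, (if γ < p j then (1:ℝ) else 0) / (1 - γ) * Real.exp (-(dotp (x j) βhat) / (1 - k)))

/-- with `ε₁ = ε = 0, ε₂ = 1`, the covariate-adaptive thresholds satisfy
`t̂_i = α·w_i`, so the procedure is the weighted Bonferroni rule `p_i ≤ min(αw_i, γ)`. -/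
theorem stmt_16 {d m : ℕ} (γ k α : ℝ) (hγ : γ ∈ Set.Ioo (0:ℝ) 1) (hk : k ∈ Set.Ioo (0:ℝ) 1)
    (hα : 0 < α) (p : Fin m → ℝ) (x : Fin m → EuclideanSpace ℝ (Fin d))
    (hp : ∃ i, γ < p i) (βhat : EuclideanSpace ℝ (Fin d)) :
    ∀ i : Fin m, tHat γ k α p x βhat i = α * wProc γ k p x βhat i ∧
      (p i ≤ min (tHat γ k α p x βhat i) γ ↔ p i ≤ min (α * wProc γ k p x βhat i) γ) := by
  obtain ⟨hγ0, hγ1⟩ := hγ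
  obtain ⟨hk0, hk1⟩ := hk
  have h1k : 0 < 1 - k := by linarith
  have h1γ : 0 < 1 - γ := by linarith
  have hpi : ∀ j, 0 < piTilde x βhat j := by
    intro j
    unfold piTilde
    positivity
  have hr : ∀ j, (1 - piTilde x βhat j) / piTilde x βhat j = Real.exp (-dotp (x j) βhat) := by
    intro j
    unfold piTilde
    have := Real.exp_pos (-dotp (x j) βhat)
    field_simp
    ring
  have hE : ∀ j, (Real.exp (-dotp (x j) βhat)) ^ (1 / (1 - k))
      = Real.exp (-(dotp (x j) βhat) / (1 - k)) := by
    intro j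
    rw [← Real.exp_mul]
    congr 1
    ring
  intro i
  have key : tHat γ k α p x βhat i = α * wProc γ k p x βhat i := by
    unfold wProc
    set S := ∑ j, (if γ < p j then (1:ℝ) else 0) / (1 - γ) *
      Real.exp (-(dotp (x j) βhat) / (1 - k)) with hS
    have hSpos : 0 < S := by
      obtain ⟨j, hj⟩ := hp
      refine Finset.sum_pos' ?_ ⟨j, Finset.mem_univ j, ?_⟩
      · intro l _
        split_ifs <;> positivity
      · rw [if_pos hj]
        positivity
    have htau : tauTilde γ k α p x βhat = k * (S / α) ^ (1 - k) := by
      unfold tauTilde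
      congr 2
      rw [hS, Finset.sum_div]
      refine Finset.sum_congr rfl fun j _ => ?_
      rw [hr, hE]
      field_simp
    have hq : 0 < S / α := by positivity
    have hqk : 0 < (S / α) ^ (1 - k) := Real.rpow_pos_of_pos hq _
    have hbase : (1 - piTilde x βhat i) * k / (piTilde x βhat i * tauTilde γ k α p x βhat)
        = Real.exp (-dotp (x i) βhat) / (S / α) ^ (1 - k) := by
      rw [htau, ← hr i]
      generalize (S / α) ^ (1 - k) = q at *
      have := hpi i
      field_simp
    unfold tHat
    rw [hbase, Real.div_rpow (Real.exp_pos _).le hqk.le, hE, ← Real.rpow_mul hq.le,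
      mul_one_div_cancel h1k.ne', Real.rpow_one]
    field_simp
  exact ⟨key, by rw [key]⟩
end
end

section
/- Let f_1 : (0,1] → (0,∞) be a continuous, strictly decreasing density with lim_{p→0+} f_1(p) = ∞, F_1(t) = ∫_0^t f_1(s)ds, and let π_1,…,π_m ∈ (0,1) and α > 0. Suppose τ* > 0 is such that the thresholds t_i* = f_1^{−1}(π_i τ*/(1−π_i)) are well defined (π_i τ*/(1−π_i) lies in the range of f_1 for every i) and the constraint binds: Σ_{i=1}^m π_i t_i* = α. Then (t_1*,…,t_m*) is a global maximizer of the objective Σ_{i=1}^m (1−π_i) F_1(t_i) over all (t_1,…,t_m) ∈ (0,1]^m satisfying Σ_{i=1}^m π_i t_i ≤ α, i.e., the constrained optimization problem max Σ(1−π_i)F_1(t_i) subject to Σπ_i F_0(t_i) ≤ α with F_0(t) = t is solved by thresholding the likelihood ratio (1−π_i)f_1(t)/π_i at the common level τ*. -/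
open MeasureTheory Filter Set
open scoped BigOperators

theorem aux_tangent (f1 : ℝ → ℝ) (hanti : StrictAntiOn f1 (Set.Ioc 0 1))
    (hint : IntegrableOn f1 (Set.Ioc 0 1)) (a b : ℝ) (ha : a ∈ Set.Ioc (0:ℝ) 1)
    (hb : b ∈ Set.Ioc (0:ℝ) 1) :
    (∫ s in (0:ℝ)..b, f1 s) ≤ (∫ s in (0:ℝ)..a, f1 s) + f1 a * (b - a) := by
  have hI : ∀ x y : ℝ, 0 ≤ x → x ≤ y → y ≤ 1 → IntervalIntegrable f1 volume x y := by
    intro x y hx hxy hy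
    rw [intervalIntegrable_iff_integrableOn_Ioc_of_le hxy]
    exact hint.mono_set (Set.Ioc_subset_Ioc hx hy)
  rcases le_total a b with h | h
  · have h1 := intervalIntegral.integral_add_adjacent_intervals
      (hI 0 a le_rfl ha.1.le ha.2) (hI a b ha.1.le h hb.2)
    have h2 : (∫ s in a..b, f1 s) ≤ ∫ s in a..b, f1 a := by
      apply intervalIntegral.integral_mono_on h (hI a b ha.1.le h hb.2) (by simp)
      intro x hx
      exact hanti.antitoneOn ha ⟨lt_of_lt_of_le ha.1 hx.1, hx.2.trans hb.2⟩ hx.1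
    rw [intervalIntegral.integral_const, smul_eq_mul] at h2
    linarith
  · have h1 := intervalIntegral.integral_add_adjacent_intervals
      (hI 0 b le_rfl hb.1.le hb.2) (hI b a hb.1.le h ha.2)
    have h2 : (∫ s in b..a, f1 a) ≤ ∫ s in b..a, f1 s := by
      apply intervalIntegral.integral_mono_on h (by simp) (hI b a hb.1.le h ha.2)
      intro x hx
      exact hanti.antitoneOn ⟨lt_of_lt_of_le hb.1 hx.1, hx.2.trans ha.2⟩ ha hx.2
    rw [intervalIntegral.integral_const, smul_eq_mul] at h2
    linarith

/-- optimality of the likelihood-ratio thresholding rule. If `f₁` is a continuous,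
strictly decreasing density on `(0,1]` blowing up at `0`, `F₁(t) = ∫_0^t f₁`, and `t_i*` satisfy
`f₁(t_i*) = π_i τ*/(1−π_i)` with the constraint binding `Σ π_i t_i* = α`, then `(t_i*)` globally
maximizes `Σ (1−π_i) F₁(t_i)` over all `t ∈ (0,1]^m` with `Σ π_i t_i ≤ α`. -/
theorem stmt_17 (m : ℕ) (f1 : ℝ → ℝ)
    (hcont : ContinuousOn f1 (Set.Ioc 0 1))
    (hanti : StrictAntiOn f1 (Set.Ioc 0 1))
    (hpos : ∀ p ∈ Set.Ioc (0:ℝ) 1, 0 < f1 p)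
    (htop : Tendsto f1 (nhdsWithin 0 (Set.Ioi 0)) atTop)
    (hint : IntegrableOn f1 (Set.Ioc 0 1))
    (hdens : (∫ s in (0:ℝ)..1, f1 s) = 1)
    (π : Fin m → ℝ) (hπ : ∀ i, π i ∈ Set.Ioo (0:ℝ) 1)
    (α : ℝ) (hα : 0 < α) (τstar : ℝ) (hτ : 0 < τstar)
    (tstar : Fin m → ℝ)
    (htstar : ∀ i, tstar i ∈ Set.Ioc (0:ℝ) 1 ∧ f1 (tstar i) = π i * τstar / (1 - π i))
    (hbind : ∑ i, π i * tstar i = α) :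
    ∀ t : Fin m → ℝ, (∀ i, t i ∈ Set.Ioc (0:ℝ) 1) → (∑ i, π i * t i) ≤ α →
      ∑ i, (1 - π i) * (∫ s in (0:ℝ)..(t i), f1 s) ≤
        ∑ i, (1 - π i) * (∫ s in (0:ℝ)..(tstar i), f1 s) := by
  intro t ht hc
  have key : ∀ i, (1 - π i) * (∫ s in (0:ℝ)..(t i), f1 s) ≤
      (1 - π i) * (∫ s in (0:ℝ)..(tstar i), f1 s) + τstar * (π i * t i - π i * tstar i) := by
    intro i
    have h1 : 0 < 1 - π i := by linarith [(hπ i).2]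
    have h := mul_le_mul_of_nonneg_left
      (aux_tangent f1 hanti hint (tstar i) (t i) (htstar i).1 (ht i)) h1.le
    rw [(htstar i).2] at h
    have e : (1 - π i) * (π i * τstar / (1 - π i) * (t i - tstar i))
        = τstar * (π i * t i - π i * tstar i) := by
      field_simp
    rw [mul_add, e] at h
    exact h
  have hs := Finset.sum_le_sum (fun i (_ : i ∈ Finset.univ) => key i)
  rw [Finset.sum_add_distrib, ← Finset.mul_sum, Finset.sum_sub_distrib, hbind] at hs
  nlinarith [mul_nonneg hτ.le (sub_nonneg.2 hc)]
end
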